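/- arXiv:2302.07312 — 2 statements merged into one kernel-verified Lean document; each statement's English description precedes it below -/
import Mathlib

section
/- Let φ_i^{(0)}, φ_i^{(1)} (i = 1, 2, 3) be smooth spherically symmetric initial data on ℝ³ supported in {|x| ≤ 1}, and suppose there exists r_0 ∈ (0, 1] such that r_0·φ_1^{(1)}(r_0) − (d/dr)(r·φ_1^{(0)}(r))|_{r = r_0} > 0 (regarding the radial data as functions of r = |x|). Then the system □φ_1 = |φ_3|³, □φ_2 = (∂_tφ_1)², □φ_3 = (∂_tφ_2)² + |φ_1|³ on [0,∞) × ℝ³ admits no global C² solution with this initial data. -/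
open Real Set MeasureTheory

noncomputable section

/-- Three-dimensional Euclidean space. -/
abbrev E3 : Type := EuclideanSpace ℝ (Fin 3)

/-- Partial derivative in time of a function of `(t, x)`. -/
def dtP (φ : ℝ → E3 → ℝ) : ℝ → E3 → ℝ := fun t x => deriv (fun s => φ s x) t

/-- Partial derivative in the `i`-th spatial coordinate. -/
def pX (i : Fin 3) (f : E3 → ℝ) : E3 → ℝ :=
  fun x => deriv (fun h : ℝ => f (x + h • (EuclideanSpace.single i (1 : ℝ)))) 0

/-- Spatial Laplacian on `ℝ³`. -/
def lap3 (f : E3 → ℝ) : E3 → ℝ := fun x => ∑ i : Fin 3, pX i (pX i f) x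

/-- The wave operator `□φ = ∂_t²φ - Δφ` on `ℝ^{1+3}`. -/
def box (φ : ℝ → E3 → ℝ) : ℝ → E3 → ℝ := fun t x => dtP (dtP φ) t x - lap3 (φ t) x

/-- A function on `ℝ³` is radial (spherically symmetric) if it depends only on `|x|`. -/
def Radial (f : E3 → ℝ) : Prop := ∀ x y : E3, ‖x‖ = ‖y‖ → f x = f y

/-- Radial representative: value of `f` at the point at distance `r` on the first axis. -/
def radRep (f : E3 → ℝ) : ℝ → ℝ := fun r => f (r • EuclideanSpace.single (0 : Fin 3) (1 : ℝ))

/-- Characteristic form of the one-dimensional wave equation `(∂_t² - ∂_r²)ψ = N` with `N ≥ 0` in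
the quadrant `t, r ≥ 0` and Dirichlet condition at `r = 0`, where `P = (∂_t - ∂_r)ψ` and
`Q = (∂_t + ∂_r)ψ`, for data such that `Q` vanishes initially in `r > 1`. -/
structure CharWave (ψ P Q N : ℝ → ℝ → ℝ) : Prop where
  zero_left : ∀ t, ψ t 0 = 0
  continuous_P : Continuous fun z : ℝ × ℝ => P z.1 z.2
  deriv_ψ : ∀ q t, HasDerivAt (fun s => ψ s (s + q)) (Q t (t + q)) t
  deriv_P : ∀ q t, HasDerivAt (fun s => P s (s + q)) (N t (t + q)) t
  deriv_Q : ∀ v t, HasDerivAt (fun s => Q s (v - s)) (N t (v - t)) t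
  init_Q : ∀ r, 1 < r → Q 0 r = 0
  source_nonneg : ∀ t r, 0 ≤ t → 0 ≤ r → 0 ≤ N t r

theorem monotoneOn_Icc_of_hasDerivAt {f f' : ℝ → ℝ} {a b : ℝ}
    (hf : ∀ x, HasDerivAt f (f' x) x) (hf' : ∀ x ∈ Icc a b, 0 ≤ f' x) :
    MonotoneOn f (Icc a b) := by
  refine monotoneOn_of_deriv_nonneg (convex_Icc a b)
    (fun x _ => (hf x).continuousAt.continuousWithinAt)
    (fun x _ => (hf x).differentiableAt.differentiableWithinAt) fun x hx => ?_
  rw [(hf x).deriv]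
  exact hf' x (interior_subset hx)

theorem mul_sub_le_of_hasDerivAt {f f' : ℝ → ℝ} {a b k : ℝ} (hab : a ≤ b)
    (hf : ∀ x, HasDerivAt f (f' x) x) (hf' : ∀ x ∈ Icc a b, k ≤ f' x) :
    k * (b - a) ≤ f b - f a := by
  have h := monotoneOn_Icc_of_hasDerivAt (f := fun x => f x - k * x) (f' := fun x => f' x - k)
    (a := a) (b := b) (fun x => (hf x).sub (by simpa using (hasDerivAt_id x).const_mul k))
    (fun x hx => sub_nonneg.2 (hf' x hx)) (left_mem_Icc.2 hab) (right_mem_Icc.2 hab) hab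
  simp only at h
  linarith

namespace CharWave

variable {ψ P Q N : ℝ → ℝ → ℝ}

theorem mul_le_Q (h : CharWave ψ P Q N) {t r a b k : ℝ} (ha : 0 ≤ a) (hab : a ≤ b) (hbt : b ≤ t)
    (hr : 0 ≤ r) (hv : 1 < t + r) (hk : ∀ s ∈ Icc a b, k ≤ N s (t + r - s)) :
    k * (b - a) ≤ Q t r := by
  have hN : ∀ s, 0 ≤ s → s ≤ t → 0 ≤ N s (t + r - s) := fun s h0 h1 =>
    h.source_nonneg _ _ h0 (by linarith)
  have h1 := mul_sub_le_of_hasDerivAt (k := 0) ha (h.deriv_Q (t + r))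
    fun s hs => hN s hs.1 (by linarith [hs.2])
  have h2 := mul_sub_le_of_hasDerivAt hab (h.deriv_Q (t + r)) hk
  have h3 := mul_sub_le_of_hasDerivAt (k := 0) hbt (h.deriv_Q (t + r))
    fun s hs => hN s (by linarith [hs.1]) hs.2
  have h0 := h.init_Q _ hv
  simp only [sub_zero, add_sub_cancel_left] at h1 h2 h3
  linarith

theorem Q_nonneg (h : CharWave ψ P Q N) {t r : ℝ} (ht : 0 ≤ t) (hr : 0 ≤ r) (hv : 1 < t + r) :
    0 ≤ Q t r := by
  simpa using h.mul_le_Q (a := 0) (b := t) (k := 0) le_rfl ht le_rfl hr hv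
    fun s hs => h.source_nonneg _ _ hs.1 (by linarith [hs.2])

theorem mul_le_ψ (h : CharWave ψ P Q N) {t r k : ℝ} (hr : 0 ≤ r)
    (hk : ∀ ρ ∈ Icc 0 r, k ≤ Q (t - r + ρ) ρ) : k * r ≤ ψ t r := by
  have h1 := mul_sub_le_of_hasDerivAt (k := k) (a := t - r) (b := t) (by linarith)
    (h.deriv_ψ (r - t)) fun s hs => by
      have := hk (s + (r - t)) ⟨by linarith [hs.1], by linarith [hs.2]⟩
      rwa [show t - r + (s + (r - t)) = s by ring] at this
  have h0 := h.zero_left (t - r)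
  simp only [sub_add_sub_cancel, sub_self, add_sub_cancel, sub_sub_cancel] at h1
  linarith

theorem ψ_nonneg (h : CharWave ψ P Q N) {t r : ℝ} (hr : 0 ≤ r) (hu : 1 < t - r) : 0 ≤ ψ t r := by
  simpa using h.mul_le_ψ (k := 0) hr fun ρ hρ =>
    h.Q_nonneg (by linarith [hρ.1]) hρ.1 (by linarith [hρ.1])

theorem le_P_of_le_init (h : CharWave ψ P Q N) {t q c : ℝ} (ht : 0 ≤ t) (hq : 0 ≤ q)
    (hc : c ≤ P 0 q) : c ≤ P t (t + q) := by
  have h1 := mul_sub_le_of_hasDerivAt (k := 0) ht (h.deriv_P q)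
    fun s hs => h.source_nonneg _ _ hs.1 (by linarith [hs.1])
  simp only [zero_add] at h1
  linarith

theorem add {ψ' P' Q' N' : ℝ → ℝ → ℝ} (h : CharWave ψ P Q N) (h' : CharWave ψ' P' Q' N') :
    CharWave (fun t r => ψ t r + ψ' t r) (fun t r => P t r + P' t r)
      (fun t r => Q t r + Q' t r) (fun t r => N t r + N' t r) where
  zero_left t := by simp [h.zero_left, h'.zero_left]
  continuous_P := h.continuous_P.add h'.continuous_P
  deriv_ψ q t := (h.deriv_ψ q t).add (h'.deriv_ψ q t)
  deriv_P q t := (h.deriv_P q t).add (h'.deriv_P q t)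
  deriv_Q q t := (h.deriv_Q q t).add (h'.deriv_Q q t)
  init_Q r hr := by simp [h.init_Q r hr, h'.init_Q r hr]
  source_nonneg t r ht hr := add_nonneg (h.source_nonneg t r ht hr) (h'.source_nonneg t r ht hr)

/-- A lower bound `ψ ≥ A r / U` in `{t - r ≥ a, t + r ≤ 4U}` improves to one with `A³` in the
smaller region `{t - r ≥ a + d, t + r ≤ 4U}`. -/
theorem improve_lower_bound (h : CharWave ψ P Q N)
    (hN : ∀ t r, 0 ≤ t → 0 < r → |ψ t r| ^ 3 / 4 ≤ r ^ 2 * N t r)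
    {U A a d : ℝ} (hU : 0 < U) (hA : 0 ≤ A) (ha : 1 < a) (hd : 0 < d)
    (hψ : ∀ t r, 0 ≤ r → a ≤ t - r → t + r ≤ 4 * U → A / U * r ≤ ψ t r)
    {t r : ℝ} (hr : 0 ≤ r) (hu : a + d ≤ t - r) (hv : t + r ≤ 4 * U) :
    (A / U) ^ 3 * d ^ 2 / 64 * r ≤ ψ t r := by
  refine h.mul_le_ψ hr fun ρ hρ => ?_
  obtain ⟨hρ0, hρr⟩ := hρ
  set τ := t - r + ρ with hτ
  have key := h.mul_le_Q (t := τ) (r := ρ) (a := (τ + ρ + a) / 2)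
    (b := (τ + ρ + a) / 2 + d / 4) (k := (A / U) ^ 3 * d / 16) (by linarith) (by linarith)
    (by linarith) hρ0 (by linarith) fun s hs => ?_
  · refine le_trans (le_of_eq ?_) key
    ring
  · obtain ⟨hs1, hs2⟩ := hs
    set x := τ + ρ - s with hx
    have hx0 : d / 4 ≤ x := by linarith
    have hxp : 0 < x := by linarith
    have h1 := hψ s x hxp.le (by linarith) (by linarith)
    have h2 := hN s x (by linarith) hxp
    have h3 : 0 ≤ A / U := by positivity
    have h4 : (A / U * x) ^ 3 ≤ |ψ s x| ^ 3 :=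
      pow_le_pow_left₀ (by positivity) (h1.trans (le_abs_self _)) 3
    have h5 : x ^ 2 * ((A / U) ^ 3 * x / 4) ≤ x ^ 2 * N s x := by nlinarith
    have h6 := le_of_mul_le_mul_left h5 (by positivity)
    refine le_trans ?_ h6
    have : 0 ≤ (A / U) ^ 3 := by positivity
    nlinarith

/-- A nonnegative source at least `|ψ|³ / (4r²)` is incompatible with `ψ ≥ 128 r / (t + r)` at
all late retarded times. -/
theorem false_of_cubic_source (h : CharWave ψ P Q N)
    (hN : ∀ t r, 0 ≤ t → 0 < r → |ψ t r| ^ 3 / 4 ≤ r ^ 2 * N t r) {U : ℝ} (hU : 1 < U)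
    (hψ : ∀ t r, 0 ≤ r → U ≤ t - r → 128 / (t + r) * r ≤ ψ t r) : False := by
  have hU0 : 0 < U := by linarith
  have key : ∀ n : ℕ, ∀ t r, 0 ≤ r → U * (2 - (1 / 2) ^ n) ≤ t - r → t + r ≤ 4 * U →
      2 ^ (n + 5) / U * r ≤ ψ t r := by
    intro n
    induction n with
    | zero =>
      intro t r hr hu hv
      have hu' : U ≤ t - r := by norm_num at hu; linarith
      refine le_trans ?_ (hψ t r hr hu')
      refine mul_le_mul_of_nonneg_right ?_ hr
      rw [div_le_div_iff₀ hU0 (by linarith)]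
      norm_num
      linarith
    | succ n ih =>
      intro t r hr hu hv
      have hp : (0 : ℝ) < (1 / 2) ^ n := by positivity
      have hp1 : (1 / 2 : ℝ) ^ n ≤ 1 := pow_le_one₀ (by norm_num) (by norm_num)
      have := h.improve_lower_bound hN hU0 (A := 2 ^ (n + 5)) (by positivity) (by nlinarith)
        (d := U * (1 / 2) ^ (n + 1)) (by positivity) ih hr
        (by rw [pow_succ] at hu ⊢; linarith) hv
      refine le_trans (mul_le_mul_of_nonneg_right ?_ hr) this
      have h2 : (2 : ℝ) ^ n * (1 / 2) ^ n = 1 := by rw [← mul_pow]; norm_num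
      have h3 : ((2 : ℝ) ^ (n + 5) / U) ^ 3 * (U * (1 / 2) ^ (n + 1)) ^ 2 / 64
          = 2 * (2 ^ (n + 1 + 5) / U) * (2 ^ n * (1 / 2) ^ n) ^ 2 := by
        field_simp
        ring
      rw [h3, h2]
      have : (0 : ℝ) ≤ 2 ^ (n + 1 + 5) / U := by positivity
      linarith
  obtain ⟨n, hn⟩ := pow_unbounded_of_one_lt (ψ (3 * U) U) (by norm_num : (1 : ℝ) < 2)
  have hp : (0 : ℝ) < (1 / 2) ^ n := by positivity
  have h1 := key n (3 * U) U hU0.le (by nlinarith) (by linarith)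
  rw [div_mul_cancel₀ _ hU0.ne', pow_add] at h1
  have : (0 : ℝ) < 2 ^ n := by positivity
  linarith

/-- A source at least `c² / r` in an outgoing strip makes `P` arbitrarily large there. -/
theorem exists_le_P_of_source (h : CharWave ψ P Q N) {c q₁ q₂ : ℝ} (hc : 0 < c) (hq₁ : 0 ≤ q₁)
    (hN : ∀ t q, 1 ≤ t → q ∈ Icc q₁ q₂ → c ≤ (t + q) * N t (t + q)) (K : ℝ) :
    ∃ T, 1 ≤ T ∧ ∀ t q, T ≤ t → q ∈ Icc q₁ q₂ → K ≤ P t (t + q) := by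
  obtain ⟨C, hC⟩ : ∃ C, ∀ q ∈ Icc q₁ q₂, C ≤ P 1 (1 + q) - c * log (1 + q) := by
    have hcont : ContinuousOn (fun q => P 1 (1 + q) - c * log (1 + q)) (Icc q₁ q₂) := by
      refine ContinuousOn.sub ?_ (continuousOn_const.mul ?_)
      · exact (h.continuous_P.comp (by fun_prop :
          Continuous fun q : ℝ => ((1 : ℝ), 1 + q))).continuousOn
      · exact ContinuousOn.log (by fun_prop) fun q hq => by linarith [hq.1]
    obtain ⟨C, hC⟩ := (isCompact_Icc.image_of_continuousOn hcont).bddBelow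
    exact ⟨C, fun q hq => hC (mem_image_of_mem _ hq)⟩
  refine ⟨max 1 (exp ((K - C) / c)), le_max_left _ _, fun t q ht hq => ?_⟩
  have ht1 : 1 ≤ t := (le_max_left _ _).trans ht
  have hq0 : 0 ≤ q := hq₁.trans hq.1
  have hmono : MonotoneOn (fun s => P s (s + q) - c * log (s + q)) (Icc 1 t) := by
    have hd : ∀ s ∈ Icc 1 t, HasDerivAt (fun s => P s (s + q) - c * log (s + q))
        (N s (s + q) - c * (1 / (s + q))) s := fun s hs =>
      (h.deriv_P q s).sub ((((hasDerivAt_id s).add_const q).log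
        (by simp only [id]; linarith [hs.1])).const_mul c)
    refine monotoneOn_of_deriv_nonneg (convex_Icc _ _)
      (fun s hs => (hd s hs).continuousAt.continuousWithinAt)
      (fun s hs => (hd s (interior_subset hs)).differentiableAt.differentiableWithinAt)
      fun s hs => ?_
    have hs' := interior_subset hs
    rw [(hd s hs').deriv]
    have hp : 0 < s + q := by linarith [hs'.1]
    have h1 : c / (s + q) ≤ N s (s + q) := by
      rw [div_le_iff₀ hp]
      linarith [hN s q hs'.1 hq]
    rw [mul_one_div]
    linarith
  have h1 := hmono (left_mem_Icc.2 ht1) (right_mem_Icc.2 ht1) ht1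
  simp only at h1
  have h2 : (K - C) / c ≤ log (t + q) := by
    rw [le_log_iff_exp_le (by linarith)]
    linarith [(le_max_right _ _).trans ht]
  rw [div_le_iff₀ hc] at h2
  linarith [hC q hq]

/-- A source at least `B / (r (q₂ - q₁))` in an outgoing strip gives `Q ≥ B / (2 (t + r))` in
the interior. -/
theorem le_ψ_of_strip_source (h : CharWave ψ P Q N) {B T q₁ q₂ : ℝ} (hT : 1 ≤ T)
    (hq₁ : 0 ≤ q₁) (hq : q₁ ≤ q₂)
    (hN : ∀ t q, T ≤ t → q ∈ Icc q₁ q₂ → B ≤ (t + q) * N t (t + q))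
    {t r : ℝ} (hr : 0 ≤ r) (hu : 2 * T + q₂ ≤ t - r) :
    B * (q₂ - q₁) / 2 / (t + r) * r ≤ ψ t r := by
  refine h.mul_le_ψ hr fun ρ hρ => ?_
  obtain ⟨hρ0, hρr⟩ := hρ
  have key := h.mul_le_Q (t := t - r + ρ) (r := ρ) (a := (t - r + ρ + ρ - q₂) / 2)
    (b := (t - r + ρ + ρ - q₁) / 2) (k := B / (t + r)) (by linarith) (by linarith)
    (by linarith) hρ0 (by linarith) fun s hs => ?_
  · refine le_trans (le_of_eq ?_) key
    ring
  · obtain ⟨hs1, hs2⟩ := hs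
    have h1 := hN s (t - r + ρ + ρ - s - s) (by linarith) ⟨by linarith, by linarith⟩
    rw [add_sub_cancel] at h1
    have h0 := h.source_nonneg s (t - r + ρ + ρ - s) (by linarith) (by linarith)
    rw [div_le_iff₀ (by linarith)]
    nlinarith

end CharWave

theorem abs_add_pow_three_le (a b : ℝ) : |a + b| ^ 3 / 4 ≤ |a| ^ 3 + |b| ^ 3 := by
  have h1 : |a + b| ^ 3 ≤ (|a| + |b|) ^ 3 := pow_le_pow_left₀ (abs_nonneg _) (abs_add_le a b) 3
  nlinarith [mul_nonneg (add_nonneg (abs_nonneg a) (abs_nonneg b)) (sq_nonneg (|a| - |b|))]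

theorem CharWave.false_of_coupled {ψ₁ P₁ Q₁ N₁ ψ₂ P₂ Q₂ N₂ ψ₃ P₃ Q₃ N₃ : ℝ → ℝ → ℝ}
    (h₁ : CharWave ψ₁ P₁ Q₁ N₁) (h₂ : CharWave ψ₂ P₂ Q₂ N₂) (h₃ : CharWave ψ₃ P₃ Q₃ N₃)
    (hN₁ : ∀ t r, 0 ≤ t → 0 < r → |ψ₃ t r| ^ 3 ≤ r ^ 2 * N₁ t r)
    (hN₂ : ∀ t r, 0 ≤ t → 0 < r → ((P₁ t r + Q₁ t r) / 2) ^ 2 ≤ r * N₂ t r)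
    (hN₃ : ∀ t r, 0 ≤ t → 0 < r → ((P₂ t r + Q₂ t r) / 2) ^ 2 ≤ r * N₃ t r)
    (hN₃' : ∀ t r, 0 ≤ t → 0 < r → |ψ₁ t r| ^ 3 ≤ r ^ 2 * N₃ t r)
    {r₀ : ℝ} (hr₀ : 0 < r₀) (hP : 0 < P₁ 0 r₀) : False := by
  obtain ⟨c, hc, q₁, q₂, hq₁, hq, hstrip⟩ : ∃ c, 0 < c ∧ ∃ q₁ q₂, 0 < q₁ ∧ q₁ < q₂ ∧
      ∀ q ∈ Icc q₁ q₂, c ≤ P₁ 0 q := by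
    have hcont : Continuous fun q => P₁ 0 q :=
      h₁.continuous_P.comp (by fun_prop : Continuous fun q : ℝ => ((0 : ℝ), q))
    have hev : ∀ᶠ q in nhds r₀, P₁ 0 r₀ / 2 < P₁ 0 q :=
      hcont.continuousAt.eventually (lt_mem_nhds (half_lt_self hP))
    obtain ⟨ε, hε, hball⟩ := Metric.eventually_nhds_iff.1 hev
    refine ⟨P₁ 0 r₀ / 2, half_pos hP, r₀, r₀ + ε / 2, hr₀, by linarith, fun q hq => ?_⟩
    refine (hball ?_).le
    rw [Real.dist_eq, abs_lt]
    constructor <;> linarith [hq.1, hq.2]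
  have hstrip₁ : ∀ t q, 1 ≤ t → q ∈ Icc q₁ q₂ → c ^ 2 / 4 ≤ (t + q) * N₂ t (t + q) := by
    intro t q ht hqm
    have hq0 : 0 < q := hq₁.trans_le hqm.1
    have h1 := h₁.le_P_of_le_init (t := t) (by linarith) hq0.le (hstrip q hqm)
    have h2 := h₁.Q_nonneg (t := t) (r := t + q) (by linarith) (by linarith) (by linarith)
    have h3 := hN₂ t (t + q) (by linarith) (by linarith)
    nlinarith
  obtain ⟨K, hK0, hK⟩ : ∃ K, 0 < K ∧ 256 ≤ K ^ 2 * (q₂ - q₁) := by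
    refine ⟨256 / (q₂ - q₁) + 1, by have := sub_pos.2 hq; positivity, ?_⟩
    have hd := sub_pos.2 hq
    have h1 : 0 ≤ 256 / (q₂ - q₁) := by positivity
    have h2 : 256 / (q₂ - q₁) * (q₂ - q₁) = 256 := div_mul_cancel₀ _ hd.ne'
    nlinarith
  obtain ⟨T, hT, hPT⟩ := h₂.exists_le_P_of_source (by positivity) hq₁.le hstrip₁ (2 * K)
  have hstrip₂ : ∀ t q, T ≤ t → q ∈ Icc q₁ q₂ → K ^ 2 ≤ (t + q) * N₃ t (t + q) := by
    intro t q ht hqm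
    have hq0 : 0 < q := hq₁.trans_le hqm.1
    have h1 := hPT t q ht hqm
    have h2 := h₂.Q_nonneg (t := t) (r := t + q) (by linarith) (by linarith) (by linarith)
    have h3 := hN₃ t (t + q) (by linarith) (by linarith)
    nlinarith
  refine (h₁.add h₃).false_of_cubic_source (U := 2 * T + q₂) ?_ (by linarith) ?_
  · intro t r ht hr
    have := abs_add_pow_three_le (ψ₁ t r) (ψ₃ t r)
    linarith [hN₁ t r ht hr, hN₃' t r ht hr]
  · intro t r hr hu
    have h1 := h₁.ψ_nonneg hr (by linarith : 1 < t - r)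
    have h3 := h₃.le_ψ_of_strip_source hT hq₁.le hq.le hstrip₂ hr hu
    have h4 : 128 / (t + r) * r ≤ K ^ 2 * (q₂ - q₁) / 2 / (t + r) * r := by
      have : 0 < t + r := by linarith
      gcongr
      linarith
    linarith

/-- Weighted integral over `(ϑ, θ) ∈ [0, π] × [0, 2π]` giving the mean over the unit sphere in
spherical coordinates. -/
def sphAvg (f : ℝ × ℝ → ℝ) : ℝ :=
  (4 * π)⁻¹ * ∫ p in Icc (0 : ℝ) π ×ˢ Icc (0 : ℝ) (2 * π), sin p.1 * f p

theorem isCompact_angles : IsCompact (Icc (0 : ℝ) π ×ˢ Icc (0 : ℝ) (2 * π)) :=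
  isCompact_Icc.prod isCompact_Icc

theorem integrableOn_angles {f : ℝ × ℝ → ℝ} (hf : Continuous f) :
    IntegrableOn f (Icc (0 : ℝ) π ×ˢ Icc (0 : ℝ) (2 * π)) :=
  hf.continuousOn.integrableOn_compact isCompact_angles

theorem sphAvg_add {f g : ℝ × ℝ → ℝ} (hf : Continuous f) (hg : Continuous g) :
    sphAvg (fun p => f p + g p) = sphAvg f + sphAvg g := by
  simp only [sphAvg, mul_add]
  rw [integral_add (integrableOn_angles (by fun_prop)) (integrableOn_angles (by fun_prop)), mul_add]

theorem sphAvg_const_mul (c : ℝ) (f : ℝ × ℝ → ℝ) :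
    sphAvg (fun p => c * f p) = c * sphAvg f := by
  simp only [sphAvg, mul_left_comm _ c, integral_const_mul]

theorem sphAvg_const (c : ℝ) : sphAvg (fun _ => c) = c := by
  rw [sphAvg, Measure.volume_eq_prod, setIntegral_prod_mul (fun x => sin x) (fun _ => c)]
  rw [integral_Icc_eq_integral_Ioc, ← intervalIntegral.integral_of_le pi_pos.le, integral_sin]
  simp [pi_pos.le]
  field_simp
  norm_num

theorem sphAvg_mono {f g : ℝ × ℝ → ℝ} (hf : Continuous f) (hg : Continuous g)
    (h : ∀ p, f p ≤ g p) : sphAvg f ≤ sphAvg g := by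
  refine mul_le_mul_of_nonneg_left ?_ (by positivity)
  refine setIntegral_mono_on (integrableOn_angles (by fun_prop)) (integrableOn_angles (by fun_prop))
    (measurableSet_Icc.prod measurableSet_Icc) fun p hp => ?_
  exact mul_le_mul_of_nonneg_left (h p) (sin_nonneg_of_mem_Icc hp.1)

theorem sphAvg_nonneg {f : ℝ × ℝ → ℝ} (hf : Continuous f) (h : ∀ p, 0 ≤ f p) : 0 ≤ sphAvg f := by
  simpa [sphAvg_const] using sphAvg_mono continuous_const hf h

theorem continuous_sphAvg {X : Type*} [TopologicalSpace X] [FirstCountableTopology X]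
    [LocallyCompactSpace X] {F : X → ℝ × ℝ → ℝ} (hF : Continuous fun z : X × ℝ × ℝ => F z.1 z.2) :
    Continuous fun x => sphAvg (F x) := by
  have hG : Continuous (Function.uncurry fun x (p : ℝ × ℝ) => sin p.1 * F x p) :=
    (by fun_prop : Continuous fun z : X × ℝ × ℝ => sin z.2.1).mul hF
  exact continuous_const.mul (continuous_parametric_integral_of_continuous hG isCompact_angles)

theorem hasDerivAt_sphAvg {F F' : ℝ → ℝ × ℝ → ℝ}
    (hF : ∀ s, Continuous (F s)) (hF' : Continuous fun z : ℝ × ℝ × ℝ => F' z.1 z.2)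
    (hd : ∀ s p, HasDerivAt (fun s => F s p) (F' s p) s) (s : ℝ) :
    HasDerivAt (fun s => sphAvg (F s)) (sphAvg (F' s)) s := by
  have hG' : Continuous fun z : ℝ × ℝ × ℝ => sin z.2.1 * F' z.1 z.2 := by fun_prop
  obtain ⟨C, hC⟩ := ((isCompact_closedBall s 1).prod isCompact_angles).exists_bound_of_continuousOn
    hG'.continuousOn
  have hcont : ∀ s, Continuous fun p : ℝ × ℝ => sin p.1 * F s p := fun s => by
    have := hF s
    fun_prop
  have hcont' : Continuous fun p : ℝ × ℝ => sin p.1 * F' s p := by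
    have : Continuous (F' s) := hF'.comp (Continuous.prodMk_right s)
    fun_prop
  have hbound : ∀ᵐ p ∂volume.restrict (Icc (0 : ℝ) π ×ˢ Icc (0 : ℝ) (2 * π)),
      ∀ x ∈ Metric.closedBall s 1, ‖sin p.1 * F' x p‖ ≤ C := by
    filter_upwards [ae_restrict_mem (measurableSet_Icc.prod measurableSet_Icc)] with p hp x hx
    exact hC (x, p) ⟨hx, hp⟩
  have key := hasDerivAt_integral_of_dominated_loc_of_deriv_le
    (F := fun s p => sin p.1 * F s p) (F' := fun s p => sin p.1 * F' s p) (bound := fun _ => C)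
    (Metric.closedBall_mem_nhds s one_pos)
    (Filter.Eventually.of_forall fun s => (hcont s).aestronglyMeasurable)
    (integrableOn_angles (hcont s)) hcont'.aestronglyMeasurable hbound
    (integrableOn_angles continuous_const)
    (Filter.Eventually.of_forall fun p x _ => (hd x p).const_mul (sin p.1))
  exact key.2.const_mul _

theorem sq_sphAvg_le {f : ℝ × ℝ → ℝ} (hf : Continuous f) :
    sphAvg f ^ 2 ≤ sphAvg (fun p => f p ^ 2) := by
  set m := sphAvg f with hm
  have h := sphAvg_mono (f := fun p => 2 * m * f p + -m ^ 2) (g := fun p => f p ^ 2)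
    (by fun_prop) (by fun_prop) fun p => by nlinarith [sq_nonneg (f p - m)]
  rw [sphAvg_add (by fun_prop) (by fun_prop), sphAvg_const_mul, sphAvg_const, ← hm] at h
  linarith

theorem abs_pow_three_tangent_le (m y : ℝ) :
    3 * m * |m| * y + -2 * |m| ^ 3 ≤ |y| ^ 3 := by
  have h1 : 3 * m * |m| * y ≤ 3 * |m| ^ 2 * |y| := by
    have : 3 * m * |m| * y ≤ |3 * m * |m| * y| := le_abs_self _
    rw [abs_mul, abs_mul, abs_mul, abs_abs] at this
    norm_num at this
    linarith
  have h2 : 0 ≤ (|y| + 2 * |m|) * (|y| - |m|) ^ 2 := by positivity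
  nlinarith

theorem abs_sphAvg_pow_three_le {f : ℝ × ℝ → ℝ} (hf : Continuous f) :
    |sphAvg f| ^ 3 ≤ sphAvg (fun p => |f p| ^ 3) := by
  set m := sphAvg f with hm
  have h := sphAvg_mono (f := fun p => 3 * m * |m| * f p + -2 * |m| ^ 3) (g := fun p => |f p| ^ 3)
    (by fun_prop) (by fun_prop) fun p => abs_pow_three_tangent_le m (f p)
  rw [sphAvg_add (by fun_prop) (by fun_prop), sphAvg_const_mul, sphAvg_const, ← hm] at h
  have : m * |m| * m = |m| ^ 3 := by
    rw [pow_succ, sq_abs]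
    ring
  linarith

theorem integral_angles_deriv_polar {G G' : ℝ × ℝ → ℝ} (hG' : Continuous G')
    (hd : ∀ a b, HasDerivAt (fun x => G (x, b)) (G' (a, b)) a)
    (h0 : ∀ b, G (0, b) = G (π, b)) :
    ∫ p in Icc (0 : ℝ) π ×ˢ Icc (0 : ℝ) (2 * π), G' p = 0 := by
  rw [Measure.volume_eq_prod, ← setIntegral_prod_swap, setIntegral_prod]
  · refine integral_eq_zero_of_ae (Filter.Eventually.of_forall fun b => ?_)
    simp only [Prod.swap_prod_mk, Pi.zero_apply]
    rw [integral_Icc_eq_integral_Ioc, ← intervalIntegral.integral_of_le pi_pos.le,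
      intervalIntegral.integral_eq_sub_of_hasDerivAt (fun x _ => hd x b)
        ((by fun_prop : Continuous fun x => G' (x, b)).intervalIntegrable _ _), h0, sub_self]
  · exact (hG'.comp continuous_swap).continuousOn.integrableOn_compact
      (isCompact_Icc.prod isCompact_Icc)

theorem integral_angles_deriv_azimuth {G G' : ℝ × ℝ → ℝ} (hG : Continuous G')
    (hd : ∀ a b, HasDerivAt (fun y => G (a, y)) (G' (a, b)) b)
    (h0 : ∀ a, G (a, 0) = G (a, 2 * π)) :
    ∫ p in Icc (0 : ℝ) π ×ˢ Icc (0 : ℝ) (2 * π), G' p = 0 := by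
  rw [Measure.volume_eq_prod, setIntegral_prod]
  · refine integral_eq_zero_of_ae (Filter.Eventually.of_forall fun a => ?_)
    simp only [Pi.zero_apply]
    rw [integral_Icc_eq_integral_Ioc, ← intervalIntegral.integral_of_le two_pi_pos.le,
      intervalIntegral.integral_eq_sub_of_hasDerivAt (fun x _ => hd a x)
        ((by fun_prop : Continuous fun x => G' (a, x)).intervalIntegrable _ _), h0, sub_self]
  · exact integrableOn_angles hG

/-- The vector of `ℝ³` with the given coordinates. -/
def vec3 (a b c : ℝ) : E3 :=
  a • EuclideanSpace.single 0 1 + b • EuclideanSpace.single 1 1 + c • EuclideanSpace.single 2 1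

/-- The unit radial vector in spherical coordinates. -/
def eRad (p : ℝ × ℝ) : E3 := vec3 (sin p.1 * cos p.2) (sin p.1 * sin p.2) (cos p.1)

/-- The unit polar vector in spherical coordinates. -/
def ePol (p : ℝ × ℝ) : E3 := vec3 (cos p.1 * cos p.2) (cos p.1 * sin p.2) (-sin p.1)

/-- The unit azimuthal vector in spherical coordinates. -/
def eAzi (p : ℝ × ℝ) : E3 := vec3 (-sin p.2) (cos p.2) 0

/-- The derivative of `eAzi` in the azimuthal angle. -/
def eAzi' (p : ℝ × ℝ) : E3 := vec3 (-cos p.2) (-sin p.2) 0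

@[fun_prop] theorem continuous_eRad : Continuous eRad := by unfold eRad vec3; fun_prop
@[fun_prop] theorem continuous_ePol : Continuous ePol := by unfold ePol vec3; fun_prop
@[fun_prop] theorem continuous_eAzi : Continuous eAzi := by unfold eAzi vec3; fun_prop
@[fun_prop] theorem continuous_eAzi' : Continuous eAzi' := by unfold eAzi' vec3; fun_prop

theorem norm_eRad (p : ℝ × ℝ) : ‖eRad p‖ = 1 := by
  rw [EuclideanSpace.norm_eq, Fin.sum_univ_three]
  simp only [eRad, vec3, PiLp.add_apply, PiLp.smul_apply, PiLp.single_apply, norm_eq_abs,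
    sq_abs, smul_eq_mul]
  simp
  nlinarith [sin_sq_add_cos_sq p.1, sin_sq_add_cos_sq p.2]

theorem hasDerivAt_vec3 {a b c : ℝ → ℝ} {a' b' c' x : ℝ} (ha : HasDerivAt a a' x)
    (hb : HasDerivAt b b' x) (hc : HasDerivAt c c' x) :
    HasDerivAt (fun x => vec3 (a x) (b x) (c x)) (vec3 a' b' c') x :=
  ((ha.smul_const _).add (hb.smul_const _)).add (hc.smul_const _)

theorem smul_vec3 (k a b c : ℝ) : k • vec3 a b c = vec3 (k * a) (k * b) (k * c) := by
  simp only [vec3, smul_add, smul_smul]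

theorem hasDerivAt_eRad_polar (a b : ℝ) :
    HasDerivAt (fun x => eRad (x, b)) (ePol (a, b)) a :=
  hasDerivAt_vec3 ((hasDerivAt_sin a).mul_const (cos b)) ((hasDerivAt_sin a).mul_const (sin b))
    (hasDerivAt_cos a)

theorem hasDerivAt_ePol_polar (a b : ℝ) :
    HasDerivAt (fun x => ePol (x, b)) ((-1 : ℝ) • eRad (a, b)) a := by
  rw [eRad, smul_vec3]
  refine (hasDerivAt_vec3 ((hasDerivAt_cos a).mul_const (cos b))
    ((hasDerivAt_cos a).mul_const (sin b)) (hasDerivAt_sin a).neg).congr_deriv ?_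
  simp only [neg_mul, one_mul]

theorem hasDerivAt_eRad_azimuth (a b : ℝ) :
    HasDerivAt (fun y => eRad (a, y)) (sin a • eAzi (a, b)) b := by
  rw [eAzi, smul_vec3]
  convert hasDerivAt_vec3 ((hasDerivAt_cos b).const_mul (sin a)) ((hasDerivAt_sin b).const_mul (sin a))
    (hasDerivAt_const b (cos a)) using 1
  congr 1; ring_nf

theorem hasDerivAt_eAzi_azimuth (a b : ℝ) :
    HasDerivAt (fun y => eAzi (a, y)) (eAzi' (a, b)) b :=
  hasDerivAt_vec3 (hasDerivAt_sin b).neg (hasDerivAt_cos b) (hasDerivAt_const b 0)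

theorem apply_vec3 (l : E3 →L[ℝ] ℝ) (a b c : ℝ) :
    l (vec3 a b c) = a * l (EuclideanSpace.single 0 1) + b * l (EuclideanSpace.single 1 1)
      + c * l (EuclideanSpace.single 2 1) := by
  simp [vec3]

theorem apply_vec3_vec3 (h : E3 →L[ℝ] E3 →L[ℝ] ℝ) (a b c : ℝ) (w : E3) :
    h (vec3 a b c) w = a * h (EuclideanSpace.single 0 1) w + b * h (EuclideanSpace.single 1 1) w
      + c * h (EuclideanSpace.single 2 1) w := by
  simp [vec3]

/-- The Laplacian in spherical coordinates, multiplied by `r sin ϑ`. -/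
theorem sin_mul_trace_eq (d : E3 →L[ℝ] ℝ) (h : E3 →L[ℝ] E3 →L[ℝ] ℝ) (r : ℝ) (p : ℝ × ℝ) :
    sin p.1 * (r * ∑ i : Fin 3, h (EuclideanSpace.single i 1) (EuclideanSpace.single i 1)) =
      sin p.1 * (r * h (eRad p) (eRad p) + 2 * d (eRad p))
      + (cos p.1 * d (ePol p) + sin p.1 * (r * h (ePol p) (ePol p) - d (eRad p)))
      + (r * sin p.1 * h (eAzi p) (eAzi p) + d (eAzi' p)) := by
  simp only [Fin.sum_univ_three, eRad, ePol, eAzi, eAzi', apply_vec3_vec3, apply_vec3]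
  have E1 := sin_sq_add_cos_sq p.1
  have E2 := sin_sq_add_cos_sq p.2
  generalize sin p.1 = s at *
  generalize cos p.1 = c at *
  generalize sin p.2 = s' at *
  generalize cos p.2 = c' at *
  generalize h (EuclideanSpace.single 0 1) (EuclideanSpace.single 0 1) = h00
  generalize h (EuclideanSpace.single 1 1) (EuclideanSpace.single 1 1) = h11
  generalize h (EuclideanSpace.single 2 1) (EuclideanSpace.single 2 1) = h22
  generalize h (EuclideanSpace.single 0 1) (EuclideanSpace.single 1 1) = h01
  generalize h (EuclideanSpace.single 1 1) (EuclideanSpace.single 0 1) = h10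
  linear_combination (-(s * r) * (h00 * c' ^ 2 + h11 * s' ^ 2 + h22 + (h01 + h10) * c' * s')
    - (c' * d (EuclideanSpace.single 0 1) + s' * d (EuclideanSpace.single 1 1))) * E1
    - s * r * (h00 + h11) * E2

/-- The spherical mean of the Laplacian: `r ⟨Δf⟩ = ⟨∂_r² (r f)⟩`. -/
theorem sphAvg_trace_eq {D : E3 → E3 →L[ℝ] ℝ} {H : E3 → E3 →L[ℝ] E3 →L[ℝ] ℝ}
    (hD : ∀ x, HasFDerivAt D (H x) x) (hH : Continuous H) (r : ℝ) :
    sphAvg (fun p => r * ∑ i : Fin 3,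
      H (r • eRad p) (EuclideanSpace.single i 1) (EuclideanSpace.single i 1)) =
    sphAvg (fun p => r * H (r • eRad p) (eRad p) (eRad p) + 2 * D (r • eRad p) (eRad p)) := by
  have hDc : Continuous D := continuous_iff_continuousAt.2 fun x => (hD x).continuousAt
  have hpol : ∫ p in Icc (0 : ℝ) π ×ˢ Icc (0 : ℝ) (2 * π), (cos p.1 * D (r • eRad p) (ePol p)
      + sin p.1 * (r * H (r • eRad p) (ePol p) (ePol p) - D (r • eRad p) (eRad p))) = 0 := by
    refine integral_angles_deriv_polar (G := fun p => sin p.1 * D (r • eRad p) (ePol p))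
      (by fun_prop) (fun a b => ?_) (by simp)
    have h1 := (hD (r • eRad (a, b))).comp_hasDerivAt a ((hasDerivAt_eRad_polar a b).const_smul r)
    refine ((hasDerivAt_sin a).mul (h1.clm_apply (hasDerivAt_ePol_polar a b))).congr_deriv ?_
    simp only [map_smul, smul_apply, smul_eq_mul, Function.comp, Pi.smul_apply, neg_mul, one_mul]
    ring
  have hazi : ∫ p in Icc (0 : ℝ) π ×ˢ Icc (0 : ℝ) (2 * π),
      (r * sin p.1 * H (r • eRad p) (eAzi p) (eAzi p) + D (r • eRad p) (eAzi' p)) = 0 := by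
    refine integral_angles_deriv_azimuth (G := fun p => D (r • eRad p) (eAzi p))
      (by fun_prop) (fun a b => ?_) (by simp [eRad, eAzi])
    have h1 := (hD (r • eRad (a, b))).comp_hasDerivAt b ((hasDerivAt_eRad_azimuth a b).const_smul r)
    refine (h1.clm_apply (hasDerivAt_eAzi_azimuth a b)).congr_deriv ?_
    simp only [map_smul, smul_apply, smul_eq_mul, Function.comp, Pi.smul_apply]
    ring
  simp only [sphAvg, fun p => sin_mul_trace_eq (D (r • eRad p)) (H (r • eRad p)) r p]
  rw [integral_add (integrableOn_angles (by fun_prop)) (integrableOn_angles (by fun_prop)),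
    integral_add (integrableOn_angles (by fun_prop)) (integrableOn_angles (by fun_prop)),
    hpol, hazi, add_zero, add_zero]

section SphericalMean

variable (φ : ℝ → E3 → ℝ)

/-- The space-time derivative of `φ`. -/
def dST (z : ℝ × E3) : ℝ × E3 →L[ℝ] ℝ := fderiv ℝ (fun p : ℝ × E3 => φ p.1 p.2) z

/-- `r` times the spherical mean of `φ(t, ·)`. -/
def meanψ (t r : ℝ) : ℝ := sphAvg fun p => r * φ t (r • eRad p)

/-- `(∂_t - ∂_r)` applied to `meanψ φ`. -/
def meanP (t r : ℝ) : ℝ :=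
  sphAvg fun p => r * dST φ (t, r • eRad p) (1, -eRad p) - φ t (r • eRad p)

/-- `(∂_t + ∂_r)` applied to `meanψ φ`. -/
def meanQ (t r : ℝ) : ℝ :=
  sphAvg fun p => r * dST φ (t, r • eRad p) (1, eRad p) + φ t (r • eRad p)

/-- `r` times the spherical mean of `□φ`. -/
def meanN (t r : ℝ) : ℝ := sphAvg fun p => r * box φ t (r • eRad p)

variable {φ}

theorem hasFDerivAt_dST (hφ : ContDiff ℝ 2 fun p : ℝ × E3 => φ p.1 p.2) (z : ℝ × E3) :
    HasFDerivAt (fun p : ℝ × E3 => φ p.1 p.2) (dST φ z) z :=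
  (hφ.differentiable (by norm_num) z).hasFDerivAt

theorem contDiff_dST (hφ : ContDiff ℝ 2 fun p : ℝ × E3 => φ p.1 p.2) : ContDiff ℝ 1 (dST φ) :=
  hφ.fderiv_right (by norm_num)

theorem hasFDerivAt_fderiv_dST (hφ : ContDiff ℝ 2 fun p : ℝ × E3 => φ p.1 p.2) (z : ℝ × E3) :
    HasFDerivAt (dST φ) (fderiv ℝ (dST φ) z) z :=
  ((contDiff_dST hφ).differentiable (by norm_num) z).hasFDerivAt

theorem continuous_fderiv_dST (hφ : ContDiff ℝ 2 fun p : ℝ × E3 => φ p.1 p.2) :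
    Continuous (fderiv ℝ (dST φ)) :=
  (contDiff_dST hφ).continuous_fderiv (by norm_num)

theorem fderiv_dST_symm (hφ : ContDiff ℝ 2 fun p : ℝ × E3 => φ p.1 p.2) (z v w : ℝ × E3) :
    fderiv ℝ (dST φ) z v w = fderiv ℝ (dST φ) z w v :=
  (hφ.contDiffAt.isSymmSndFDerivAt (by simp)) v w

theorem hasDerivAt_const_line (t : ℝ) (x : E3) :
    HasDerivAt (fun s : ℝ => (s, x)) ((1, 0) : ℝ × E3) t :=
  (hasDerivAt_id t).prodMk (hasDerivAt_const t x)

theorem dtP_eq (hφ : ContDiff ℝ 2 fun p : ℝ × E3 => φ p.1 p.2) (t : ℝ) (x : E3) :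
    dtP φ t x = dST φ (t, x) (1, 0) :=
  ((hasFDerivAt_dST hφ (t, x)).comp_hasDerivAt_of_eq t (hasDerivAt_const_line t x) rfl).deriv

theorem dtP_dtP_eq (hφ : ContDiff ℝ 2 fun p : ℝ × E3 => φ p.1 p.2) (t : ℝ) (x : E3) :
    dtP (dtP φ) t x = fderiv ℝ (dST φ) (t, x) (1, 0) (1, 0) := by
  have h := ((hasFDerivAt_fderiv_dST hφ (t, x)).comp_hasDerivAt_of_eq t
    (hasDerivAt_const_line t x) rfl).clm_apply (hasDerivAt_const t ((1, 0) : ℝ × E3))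
  rw [map_zero, add_zero] at h
  have he : (fun s => dtP φ s x) = fun s => dST φ (s, x) (1, 0) := funext fun s => dtP_eq hφ s x
  rw [dtP, he]
  exact h.deriv

theorem hasDerivAt_line (t : ℝ) (x e : E3) :
    HasDerivAt (fun h : ℝ => (t, x + h • e)) ((0, e) : ℝ × E3) 0 := by
  have h := (hasDerivAt_const (0 : ℝ) t).prodMk (((hasDerivAt_id (0 : ℝ)).smul_const e).const_add x)
  simpa using h

theorem pX_eq (hφ : ContDiff ℝ 2 fun p : ℝ × E3 => φ p.1 p.2) (i : Fin 3) (t : ℝ) (x : E3) :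
    pX i (φ t) x = dST φ (t, x) (0, EuclideanSpace.single i 1) :=
  (HasFDerivAt.comp_hasDerivAt_of_eq (0 : ℝ) (hasFDerivAt_dST hφ (t, x))
    (hasDerivAt_line t x _) (by simp)).deriv

theorem pX_pX_eq (hφ : ContDiff ℝ 2 fun p : ℝ × E3 => φ p.1 p.2) (i : Fin 3) (t : ℝ) (x : E3) :
    pX i (pX i (φ t)) x = fderiv ℝ (dST φ) (t, x) (0, EuclideanSpace.single i 1)
      (0, EuclideanSpace.single i 1) := by
  have h := (HasFDerivAt.comp_hasDerivAt_of_eq (0 : ℝ) (hasFDerivAt_fderiv_dST hφ (t, x))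
    (hasDerivAt_line t x (EuclideanSpace.single i 1)) (by simp)).clm_apply
      (hasDerivAt_const (0 : ℝ) ((0, EuclideanSpace.single i 1) : ℝ × E3))
  rw [map_zero, add_zero] at h
  have he : pX i (φ t) = fun y => dST φ (t, y) (0, EuclideanSpace.single i 1) :=
    funext fun y => pX_eq hφ i t y
  rw [he]
  exact h.deriv

theorem box_eq (hφ : ContDiff ℝ 2 fun p : ℝ × E3 => φ p.1 p.2) (t : ℝ) (x : E3) :
    box φ t x = fderiv ℝ (dST φ) (t, x) (1, 0) (1, 0) -
      ∑ i : Fin 3, fderiv ℝ (dST φ) (t, x) (0, EuclideanSpace.single i 1)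
        (0, EuclideanSpace.single i 1) := by
  simp only [box, lap3, dtP_dtP_eq hφ, pX_pX_eq hφ]

theorem continuous_box (hφ : ContDiff ℝ 2 fun p : ℝ × E3 => φ p.1 p.2) :
    Continuous fun z : ℝ × E3 => box φ z.1 z.2 := by
  have := continuous_fderiv_dST hφ
  simp only [box_eq hφ]
  fun_prop

/-- The radial part of the wave operator has the same spherical mean as the full one. -/
theorem meanN_eq (hφ : ContDiff ℝ 2 fun p : ℝ × E3 => φ p.1 p.2) (t r : ℝ) :
    meanN φ t r = sphAvg fun p =>
      r * fderiv ℝ (dST φ) (t, r • eRad p) (1, eRad p) (1, -eRad p)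
        - 2 * dST φ (t, r • eRad p) (0, eRad p) := by
  have hH := continuous_fderiv_dST hφ
  have hDc := (contDiff_dST hφ).continuous
  have key := sphAvg_trace_eq
    (D := fun x => (dST φ (t, x)).comp (ContinuousLinearMap.inr ℝ ℝ E3))
    (H := fun x => ((ContinuousLinearMap.compL ℝ E3 (ℝ × E3) ℝ).flip
      (ContinuousLinearMap.inr ℝ ℝ E3)).comp
        ((fderiv ℝ (dST φ) (t, x)).comp (ContinuousLinearMap.inr ℝ ℝ E3)))
    (fun x => ?_) (by fun_prop) r
  · simp only [ContinuousLinearMap.comp_apply, ContinuousLinearMap.flip_apply,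
      ContinuousLinearMap.compL_apply, ContinuousLinearMap.inr_apply] at key
    have h1 : meanN φ t r
        = sphAvg (fun p => r * fderiv ℝ (dST φ) (t, r • eRad p) (1, 0) (1, 0)
          + -1 * (r * ∑ i : Fin 3, fderiv ℝ (dST φ) (t, r • eRad p)
            (0, EuclideanSpace.single i 1) (0, EuclideanSpace.single i 1))) := by
      simp only [meanN, box_eq hφ]
      congr 1
      ext p
      ring
    rw [h1, sphAvg_add (by fun_prop) (by fun_prop), sphAvg_const_mul (-1), key,
      ← sphAvg_const_mul (-1),
      ← sphAvg_add (by fun_prop) (by fun_prop)]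
    congr 1
    ext p
    have hs := fderiv_dST_symm hφ (t, r • eRad p) (1, 0) (0, eRad p)
    have e1 : ((1, eRad p) : ℝ × E3) = (1, 0) + (0, eRad p) := by simp
    have e2 : ((1, -eRad p) : ℝ × E3) = (1, 0) - (0, eRad p) := by simp
    rw [e1, e2, map_add, map_sub, add_apply, add_apply, hs]
    ring
  · have h1 : HasFDerivAt (fun x : E3 => (t, x)) (ContinuousLinearMap.inr ℝ ℝ E3) x :=
      hasFDerivAt_prodMk_right t x
    have h2 := (hasFDerivAt_fderiv_dST hφ (t, x)).comp x h1
    exact (((ContinuousLinearMap.compL ℝ E3 (ℝ × E3) ℝ).flip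
      (ContinuousLinearMap.inr ℝ ℝ E3)).hasFDerivAt).comp x h2

theorem hasDerivAt_ray {ρ : ℝ → ℝ} {ρ' s : ℝ} (hρ : HasDerivAt ρ ρ' s) (e : E3) :
    HasDerivAt (fun s => (s, ρ s • e)) ((1, ρ' • e) : ℝ × E3) s :=
  (hasDerivAt_id s).prodMk (hρ.smul_const e)

theorem hasDerivAt_meanψ (hφ : ContDiff ℝ 2 fun p : ℝ × E3 => φ p.1 p.2) (q t : ℝ) :
    HasDerivAt (fun s => meanψ φ s (s + q)) (meanQ φ t (t + q)) t := by
  have hc := hφ.continuous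
  have hDc := (contDiff_dST hφ).continuous
  refine hasDerivAt_sphAvg (F := fun s p => (s + q) * φ s ((s + q) • eRad p))
    (F' := fun s p => (s + q) * dST φ (s, (s + q) • eRad p) (1, eRad p) + φ s ((s + q) • eRad p))
    (fun s => ?_) ?_ (fun s p => ?_) t
  · exact continuous_const.mul
      (hc.comp (by fun_prop : Continuous fun p => (s, (s + q) • eRad p)))
  · exact Continuous.add (by fun_prop)
      (hc.comp (by fun_prop : Continuous fun z : ℝ × ℝ × ℝ => (z.1, (z.1 + q) • eRad z.2)))
  · have hl := (hasDerivAt_id s).add_const q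
    have h := hl.mul ((hasFDerivAt_dST hφ _).comp_hasDerivAt s (hasDerivAt_ray hl (eRad p)))
    refine h.congr_deriv ?_
    simp only [one_smul, one_mul, Function.comp, id]
    ring

theorem hasDerivAt_meanP (hφ : ContDiff ℝ 2 fun p : ℝ × E3 => φ p.1 p.2) (q t : ℝ) :
    HasDerivAt (fun s => meanP φ s (s + q)) (meanN φ t (t + q)) t := by
  have hc := hφ.continuous
  have hDc := (contDiff_dST hφ).continuous
  have hH := continuous_fderiv_dST hφ
  rw [meanN_eq hφ]
  refine hasDerivAt_sphAvg
    (F := fun s p => (s + q) * dST φ (s, (s + q) • eRad p) (1, -eRad p) - φ s ((s + q) • eRad p))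
    (F' := fun s p => (s + q) * fderiv ℝ (dST φ) (s, (s + q) • eRad p) (1, eRad p) (1, -eRad p)
        - 2 * dST φ (s, (s + q) • eRad p) (0, eRad p)) (fun s => ?_) (by fun_prop)
    (fun s p => ?_) t
  · exact Continuous.sub (by fun_prop)
      (hc.comp (by fun_prop : Continuous fun p => (s, (s + q) • eRad p)))
  · have hl := (hasDerivAt_id s).add_const q
    have hr := hasDerivAt_ray hl (eRad p)
    have h := (hl.mul (((hasFDerivAt_fderiv_dST hφ _).comp_hasDerivAt s hr).clm_apply
      (hasDerivAt_const s ((1, -eRad p) : ℝ × E3)))).sub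
        ((hasFDerivAt_dST hφ _).comp_hasDerivAt s hr)
    refine h.congr_deriv ?_
    have e1 : ((1, -eRad p) : ℝ × E3) = (1, eRad p) - (2 : ℝ) • (0, eRad p) := by
      ext1 <;> simp [two_smul]
    simp only [one_smul, one_mul, Function.comp, id, map_zero, add_zero]
    nth_rewrite 1 [e1]
    rw [map_sub, map_smul, smul_eq_mul]
    ring

theorem hasDerivAt_meanQ (hφ : ContDiff ℝ 2 fun p : ℝ × E3 => φ p.1 p.2) (v t : ℝ) :
    HasDerivAt (fun s => meanQ φ s (v - s)) (meanN φ t (v - t)) t := by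
  have hc := hφ.continuous
  have hDc := (contDiff_dST hφ).continuous
  have hH := continuous_fderiv_dST hφ
  rw [meanN_eq hφ]
  refine hasDerivAt_sphAvg
    (F := fun s p => (v - s) * dST φ (s, (v - s) • eRad p) (1, eRad p) + φ s ((v - s) • eRad p))
    (F' := fun s p => (v - s) * fderiv ℝ (dST φ) (s, (v - s) • eRad p) (1, eRad p) (1, -eRad p)
        - 2 * dST φ (s, (v - s) • eRad p) (0, eRad p)) (fun s => ?_) (by fun_prop)
    (fun s p => ?_) t
  · exact Continuous.add (by fun_prop)
      (hc.comp (by fun_prop : Continuous fun p => (s, (v - s) • eRad p)))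
  · have hl := (hasDerivAt_id s).const_sub v
    have hr := hasDerivAt_ray hl (eRad p)
    have h := (hl.mul (((hasFDerivAt_fderiv_dST hφ _).comp_hasDerivAt s hr).clm_apply
      (hasDerivAt_const s ((1, eRad p) : ℝ × E3)))).add
        ((hasFDerivAt_dST hφ _).comp_hasDerivAt s hr)
    refine h.congr_deriv ?_
    have e1 : dST φ (s, (v - s) • eRad p) (1, -eRad p) = dST φ (s, (v - s) • eRad p) (1, eRad p)
        - 2 * dST φ (s, (v - s) • eRad p) (0, eRad p) := by
      rw [← smul_eq_mul, ← map_smul, ← map_sub]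
      congr 1
      ext1 <;> simp [two_smul]
    simp only [neg_smul, one_smul, Function.comp, id, map_zero, add_zero]
    rw [e1, fderiv_dST_symm hφ _ (1, -eRad p)]
    ring

theorem continuous_meanP (hφ : ContDiff ℝ 2 fun p : ℝ × E3 => φ p.1 p.2) :
    Continuous fun z : ℝ × ℝ => meanP φ z.1 z.2 := by
  have hDc := (contDiff_dST hφ).continuous
  refine continuous_sphAvg (F := fun z : ℝ × ℝ => fun p =>
    z.2 * dST φ (z.1, z.2 • eRad p) (1, -eRad p) - φ z.1 (z.2 • eRad p)) ?_
  exact Continuous.sub (by fun_prop) (hφ.continuous.comp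
    (by fun_prop : Continuous fun w : (ℝ × ℝ) × ℝ × ℝ => (w.1.1, w.1.2 • eRad w.2)))

theorem hasDerivAt_initial_radial (hφ : ContDiff ℝ 2 fun p : ℝ × E3 => φ p.1 p.2) (e : E3) (r : ℝ) :
    HasDerivAt (fun s => s * φ 0 (s • e)) (φ 0 (r • e) + r * dST φ (0, r • e) (0, e)) r := by
  have h1 : HasDerivAt (fun s : ℝ => (0, s • e)) ((0, e) : ℝ × E3) r := by
    simpa using (hasDerivAt_const r (0 : ℝ)).prodMk ((hasDerivAt_id r).smul_const e)
  refine ((hasDerivAt_id r).mul ((hasFDerivAt_dST hφ _).comp_hasDerivAt r h1)).congr_deriv ?_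
  simp

theorem meanQ_init_eq_zero (hφ : ContDiff ℝ 2 fun p : ℝ × E3 => φ p.1 p.2)
    (h0 : ∀ x : E3, 1 < ‖x‖ → φ 0 x = 0) (h1 : ∀ x : E3, 1 < ‖x‖ → dtP φ 0 x = 0)
    {r : ℝ} (hr : 1 < r) : meanQ φ 0 r = 0 := by
  have hn : ∀ s > (1 : ℝ), ∀ p, 1 < ‖s • eRad p‖ := fun s hs p => by
    rw [norm_smul, norm_eRad, mul_one, norm_eq_abs]
    exact hs.trans_le (le_abs_self s)
  suffices h : ∀ p, r * dST φ (0, r • eRad p) (1, eRad p) + φ 0 (r • eRad p) = 0 by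
    simp only [meanQ, h, sphAvg_const]
  intro p
  have hz : (fun s => s * φ 0 (s • eRad p)) =ᶠ[nhds r] fun _ => 0 := by
    filter_upwards [lt_mem_nhds hr] with s hs
    rw [h0 _ (hn s hs p), mul_zero]
  have hd := (hasDerivAt_initial_radial hφ (eRad p) r).unique
    ((hasDerivAt_const r (0 : ℝ)).congr_of_eventuallyEq hz)
  have ht := h1 _ (hn r hr p)
  rw [dtP_eq hφ] at ht
  have e1 : ((1, eRad p) : ℝ × E3) = (1, 0) + (0, eRad p) := by simp
  rw [e1, map_add, ht]
  linarith

theorem charWave_mean (hφ : ContDiff ℝ 2 fun p : ℝ × E3 => φ p.1 p.2)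
    (hF : ∀ t x, 0 ≤ t → 0 ≤ box φ t x)
    (h0 : ∀ x : E3, 1 < ‖x‖ → φ 0 x = 0) (h1 : ∀ x : E3, 1 < ‖x‖ → dtP φ 0 x = 0) :
    CharWave (meanψ φ) (meanP φ) (meanQ φ) (meanN φ) where
  zero_left t := by simp [meanψ, sphAvg_const]
  continuous_P := continuous_meanP hφ
  deriv_ψ := hasDerivAt_meanψ hφ
  deriv_P := hasDerivAt_meanP hφ
  deriv_Q := hasDerivAt_meanQ hφ
  init_Q _ hr := meanQ_init_eq_zero hφ h0 h1 hr
  source_nonneg t r ht hr := by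
    refine sphAvg_nonneg (continuous_const.mul ((continuous_box hφ).comp
      (by fun_prop : Continuous fun p => (t, r • eRad p)))) fun p => mul_nonneg hr (hF _ _ ht)

theorem continuous_dtP (hφ : ContDiff ℝ 2 fun p : ℝ × E3 => φ p.1 p.2) :
    Continuous fun z : ℝ × E3 => dtP φ z.1 z.2 := by
  have hDc := (contDiff_dST hφ).continuous
  simp only [dtP_eq hφ]
  fun_prop

theorem meanP_add_meanQ (hφ : ContDiff ℝ 2 fun p : ℝ × E3 => φ p.1 p.2) (t r : ℝ) :
    (meanP φ t r + meanQ φ t r) / 2 = r * sphAvg (fun p => dtP φ t (r • eRad p)) := by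
  have hDc := (contDiff_dST hφ).continuous
  have hc : Continuous fun p => φ t (r • eRad p) :=
    hφ.continuous.comp (by fun_prop : Continuous fun p => (t, r • eRad p))
  rw [meanP, meanQ, ← sphAvg_add (by fun_prop) (by fun_prop), ← sphAvg_const_mul,
    div_eq_inv_mul, ← sphAvg_const_mul]
  congr 1
  ext p
  have e1 : dST φ (t, r • eRad p) (1, -eRad p) + dST φ (t, r • eRad p) (1, eRad p)
      = 2 * dST φ (t, r • eRad p) (1, 0) := by
    rw [← map_add, ← smul_eq_mul, ← map_smul]
    congr 1
    ext1 <;> simp [one_add_one_eq_two]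
  rw [dtP_eq hφ]
  linear_combination r / 2 * e1

variable {χ : ℝ → E3 → ℝ}

theorem sq_mean_dtP_le (hφ : ContDiff ℝ 2 fun p : ℝ × E3 => φ p.1 p.2)
    (hχ : ContDiff ℝ 2 fun p : ℝ × E3 => χ p.1 p.2)
    (h : ∀ t x, 0 ≤ t → dtP χ t x ^ 2 ≤ box φ t x) {t r : ℝ} (ht : 0 ≤ t) :
    ((meanP χ t r + meanQ χ t r) / 2) ^ 2 ≤ r * meanN φ t r := by
  have hγ : Continuous fun p => (t, r • eRad p) := by fun_prop
  have hc := (continuous_dtP hχ).comp hγ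
  have h1 := sq_sphAvg_le hc
  have h2 := sphAvg_mono (hc.pow 2) ((continuous_box hφ).comp hγ) fun p => h t _ ht
  rw [meanP_add_meanQ hχ, meanN, sphAvg_const_mul, mul_pow, sq r, ← mul_assoc]
  exact mul_le_mul_of_nonneg_left (h1.trans h2) (mul_self_nonneg r)

theorem abs_meanψ_pow_three_le (hφ : ContDiff ℝ 2 fun p : ℝ × E3 => φ p.1 p.2)
    (hχ : ContDiff ℝ 2 fun p : ℝ × E3 => χ p.1 p.2)
    (h : ∀ t x, 0 ≤ t → |χ t x| ^ 3 ≤ box φ t x) {t r : ℝ} (ht : 0 ≤ t) (hr : 0 < r) :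
    |meanψ χ t r| ^ 3 ≤ r ^ 2 * meanN φ t r := by
  have hγ : Continuous fun p => (t, r • eRad p) := by fun_prop
  have hc := hχ.continuous.comp hγ
  have h1 := abs_sphAvg_pow_three_le hc
  have h2 := sphAvg_mono (hc.abs.pow 3) ((continuous_box hφ).comp hγ) fun p => h t _ ht
  rw [meanψ, meanN, sphAvg_const_mul, sphAvg_const_mul, abs_mul, abs_of_pos hr, mul_pow,
    ← mul_assoc, ← pow_succ]
  exact mul_le_mul_of_nonneg_left (h1.trans h2) (by positivity)

theorem meanP_init_eq {φ0 φ1 : E3 → ℝ} (hφ : ContDiff ℝ 2 fun p : ℝ × E3 => φ p.1 p.2)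
    (h0 : ∀ x, φ 0 x = φ0 x) (h1 : ∀ x, dtP φ 0 x = φ1 x) (hr0 : Radial φ0) (hr1 : Radial φ1)
    (r : ℝ) :
    meanP φ 0 r = r * radRep φ1 r - deriv (fun r : ℝ => r * radRep φ0 r) r := by
  have hrep : ∀ {f : E3 → ℝ}, Radial f → ∀ s p, f (s • eRad p) = radRep f s := fun hf s p =>
    hf _ _ (by simp [norm_smul, norm_eRad])
  suffices h : ∀ p, r * dST φ (0, r • eRad p) (1, -eRad p) - φ 0 (r • eRad p)
      = r * radRep φ1 r - deriv (fun r : ℝ => r * radRep φ0 r) r by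
    simp only [meanP, h, sphAvg_const]
  intro p
  have hd := (hasDerivAt_initial_radial hφ (eRad p) r).deriv
  simp only [h0, hrep hr0] at hd
  have ht := h1 (r • eRad p)
  rw [dtP_eq hφ, hrep hr1] at ht
  have e1 : ((1, -eRad p) : ℝ × E3) = (1, 0) - (0, eRad p) := by simp
  rw [e1, map_sub, ht, hd, h0, hrep hr0]
  ring

end SphericalMean

/-- Blow-up for the critical system `□φ₁ = |φ₃|³`, `□φ₂ = (∂_tφ₁)²`,
`□φ₃ = (∂_tφ₂)² + |φ₁|³` in `ℝ^{3+1}`: for smooth spherically symmetric data supported in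
the unit ball with `r₀φ₁^{(1)}(r₀) - d/dr(rφ₁^{(0)})|_{r₀} > 0` at some `r₀ ∈ (0,1]`,
there is no global `C²` solution. -/
theorem stmt_14 (φ10 φ20 φ30 φ11 φ21 φ31 : E3 → ℝ)
    (hsm0 : ContDiff ℝ (⊤ : ℕ∞) φ10 ∧ ContDiff ℝ (⊤ : ℕ∞) φ20 ∧ ContDiff ℝ (⊤ : ℕ∞) φ30)
    (hsm1 : ContDiff ℝ (⊤ : ℕ∞) φ11 ∧ ContDiff ℝ (⊤ : ℕ∞) φ21 ∧ ContDiff ℝ (⊤ : ℕ∞) φ31)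
    (hrad : Radial φ10 ∧ Radial φ20 ∧ Radial φ30 ∧ Radial φ11 ∧ Radial φ21 ∧ Radial φ31)
    (hsupp : ∀ x : E3, 1 < ‖x‖ →
      φ10 x = 0 ∧ φ20 x = 0 ∧ φ30 x = 0 ∧ φ11 x = 0 ∧ φ21 x = 0 ∧ φ31 x = 0)
    (r0 : ℝ) (hr0 : 0 < r0) (hr0' : r0 ≤ 1)
    (hseed : 0 < r0 * radRep φ11 r0 - deriv (fun r : ℝ => r * radRep φ10 r) r0) :
    ¬ ∃ φ1 φ2 φ3 : ℝ → E3 → ℝ,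
      ContDiff ℝ 2 (fun p : ℝ × E3 => φ1 p.1 p.2) ∧
      ContDiff ℝ 2 (fun p : ℝ × E3 => φ2 p.1 p.2) ∧
      ContDiff ℝ 2 (fun p : ℝ × E3 => φ3 p.1 p.2) ∧
      (∀ (t : ℝ) (x : E3), 0 ≤ t → box φ1 t x = |φ3 t x| ^ (3 : ℕ)) ∧
      (∀ (t : ℝ) (x : E3), 0 ≤ t → box φ2 t x = (dtP φ1 t x) ^ (2 : ℕ)) ∧
      (∀ (t : ℝ) (x : E3), 0 ≤ t →
        box φ3 t x = (dtP φ2 t x) ^ (2 : ℕ) + |φ1 t x| ^ (3 : ℕ)) ∧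
      (∀ x : E3, φ1 0 x = φ10 x ∧ φ2 0 x = φ20 x ∧ φ3 0 x = φ30 x) ∧
      (∀ x : E3, dtP φ1 0 x = φ11 x ∧ dtP φ2 0 x = φ21 x ∧ dtP φ3 0 x = φ31 x) := by
  rintro ⟨φ1, φ2, φ3, hc1, hc2, hc3, he1, he2, he3, hd0, hd1⟩
  have w1 := charWave_mean hc1 (fun t x ht => by rw [he1 t x ht]; positivity)
    (fun x hx => by rw [(hd0 x).1, (hsupp x hx).1])
    (fun x hx => by rw [(hd1 x).1, (hsupp x hx).2.2.2.1])
  have w2 := charWave_mean hc2 (fun t x ht => by rw [he2 t x ht]; positivity)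
    (fun x hx => by rw [(hd0 x).2.1, (hsupp x hx).2.1])
    (fun x hx => by rw [(hd1 x).2.1, (hsupp x hx).2.2.2.2.1])
  have w3 := charWave_mean hc3 (fun t x ht => by rw [he3 t x ht]; positivity)
    (fun x hx => by rw [(hd0 x).2.2, (hsupp x hx).2.2.1])
    (fun x hx => by rw [(hd1 x).2.2, (hsupp x hx).2.2.2.2.2])
  refine w1.false_of_coupled w2 w3
    (fun t r ht hr => abs_meanψ_pow_three_le hc1 hc3 (fun t x ht => (he1 t x ht).ge) ht hr)
    (fun t r ht _ => sq_mean_dtP_le hc2 hc1 (fun t x ht => (he2 t x ht).ge) ht)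
    (fun t r ht _ => sq_mean_dtP_le hc3 hc2 (fun t x ht => ?_) ht)
    (fun t r ht hr => abs_meanψ_pow_three_le hc3 hc1 (fun t x ht => ?_) ht hr) hr0 ?_
  · rw [he3 t x ht]
    exact le_add_of_nonneg_right (by positivity)
  · rw [he3 t x ht]
    exact le_add_of_nonneg_left (by positivity)
  · rwa [meanP_init_eq hc1 (fun x => (hd0 x).1) (fun x => (hd1 x).1) hrad.1 hrad.2.2.2.1]

end
end

section
/- Let φ_i^{(0)}, φ_i^{(1)} (i = 1, …, 4) be smooth spherically symmetric initial data on ℝ³ supported in {|x| ≤ 1}, with the data (φ_1^{(0)}, φ_1^{(1)}) for φ_1 not identically zero, and let (φ_1, φ_2, φ_3, φ_4) be a global smooth solution on [0,∞) × ℝ³ of □φ_1 = 0, □φ_2 = φ_1², □φ_3 = φ_2², □φ_4 = φ_3² with this data. Then at least one of the two equations (1 + ∂_vφ_4)·□η = (∂_vφ_4)² and (1 − ∂_vφ_4)·□η = (∂_vφ_4)² admits no global smooth solution η on [0,∞) × ℝ³ (for any choice of smooth data for η); here ∂_vφ_4 = ∂_tφ_4 + ∂_rφ_4 is the outgoing null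 derivative of the radial function φ_4. -/
open Real Set MeasureTheory

noncomputable section

/-- Outgoing null derivative `∂_v = ∂_t + ∂_r` of a radial function of `(t, x)`, the
radial derivative being the directional derivative along `x/|x|`. -/
def dvNull (φ : ℝ → E3 → ℝ) : ℝ → E3 → ℝ := fun t x =>
  dtP φ t x + deriv (fun ρ : ℝ => φ t (x + ρ • (‖x‖⁻¹ • x))) 0

theorem sub_le_of_hasDerivAt_le {F F' : ℝ → ℝ} {a b c : ℝ} (hab : a ≤ b)
    (h : ∀ x ∈ Icc a b, HasDerivAt F (F' x) x) (hc : ∀ x ∈ Ioo a b, F' x ≤ c) :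
    F b - F a ≤ c * (b - a) := by
  refine (convex_Icc a b).image_sub_le_mul_sub_of_deriv_le
    (fun x hx => (h x hx).continuousAt.continuousWithinAt)
    (fun x hx => ?_) (fun x hx => ?_) a (left_mem_Icc.2 hab) b (right_mem_Icc.2 hab) hab
  · exact (h x (interior_subset hx)).differentiableAt.differentiableWithinAt
  · rw [(h x (interior_subset hx)).deriv]
    rw [interior_Icc] at hx
    exact hc x hx

theorem le_sub_of_le_hasDerivAt {F F' : ℝ → ℝ} {a b c : ℝ} (hab : a ≤ b)
    (h : ∀ x ∈ Icc a b, HasDerivAt F (F' x) x) (hc : ∀ x ∈ Ioo a b, c ≤ F' x) :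
    c * (b - a) ≤ F b - F a := by
  have := sub_le_of_hasDerivAt_le (F := fun x => - F x) (F' := fun x => - F' x) (c := -c) hab
    (fun x hx => (h x hx).neg) (fun x hx => neg_le_neg (hc x hx))
  linarith

/-- For a radial function `φ` written as `f` in the null coordinates `u = t - r`, `v = t + r`,
with `G = ∂f/∂v`, this is the `v`-derivative of `r φ`. -/
def nullD (f G : ℝ → ℝ → ℝ) (u v : ℝ) : ℝ := f u v / 2 + (v - u) / 2 * G u v

/-- The radial wave equation `□φ = S` on `t ≥ 0` in null coordinates, with data supported in the
unit ball. -/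
structure NullWave (f G S : ℝ → ℝ → ℝ) : Prop where
  cont : Continuous (fun p : ℝ × ℝ => f p.1 p.2)
  symm : ∀ u v, f u v = f v u
  derivV : ∀ u v, HasDerivAt (fun w => f u w) (G u v) v
  derivU : ∀ u v, 0 ≤ u + v → HasDerivAt (fun w => nullD f G w v) ((v - u) / 8 * S u v) u
  zero_f : ∀ v, 1 < v → f (-v) v = 0
  zero_D : ∀ v, 1 < v → nullD f G (-v) v = 0

namespace NullWave

variable {f G S : ℝ → ℝ → ℝ}

theorem derivP (h : NullWave f G S) (u v : ℝ) :
    HasDerivAt (fun w => (w - u) / 2 * f u w) (nullD f G u v) v := by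
  have h1 : HasDerivAt (fun w : ℝ => (w - u) / 2) (1 / 2) v :=
    ((hasDerivAt_id v).sub_const u).div_const 2
  exact (h1.mul (h.derivV u v)).congr_deriv (by unfold nullD; ring)

theorem D_eq_zero (h : NullWave f G S) {u v : ℝ} (hv : 1 < v) (huv : 0 ≤ u + v)
    (hS : ∀ w, -v ≤ w → w < u → S w v = 0) : nullD f G u v = 0 := by
  have h1 := sub_le_of_hasDerivAt_le (c := 0) (by linarith : -v ≤ u)
    (fun x hx => h.derivU x v (by linarith [hx.1])) (fun x hx => by
      rw [hS x hx.1.le hx.2]; simp)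
  have h2 := le_sub_of_le_hasDerivAt (c := 0) (by linarith : -v ≤ u)
    (fun x hx => h.derivU x v (by linarith [hx.1])) (fun x hx => by
      rw [hS x hx.1.le hx.2]; simp)
  have := h.zero_D v hv
  linarith

theorem exterior (h : NullWave f G S) (hS : ∀ u v, u < -1 → 0 ≤ u + v → S u v = 0)
    {u v : ℝ} (hu : u < -1) (huv : 0 ≤ u + v) : f u v = 0 := by
  have hD : ∀ w, -u ≤ w → nullD f G u w = 0 := fun w hw =>
    h.D_eq_zero (by linarith) (by linarith) fun z hz hzu => hS z w (by linarith) (by linarith)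
  have h1 := sub_le_of_hasDerivAt_le (c := 0) (by linarith : -u ≤ v)
    (fun x _ => h.derivP u x) (fun x hx => (hD x hx.1.le).le)
  have h2 := le_sub_of_le_hasDerivAt (c := 0) (by linarith : -u ≤ v)
    (fun x _ => h.derivP u x) (fun x hx => (hD x hx.1.le).ge)
  have h3 := h.zero_f (-u) (by linarith)
  rw [neg_neg] at h3
  simp only [h3] at h1 h2
  have h4 : (v - u) / 2 * f u v = 0 := by linarith
  rcases mul_eq_zero.1 h4 with h5 | h5
  · linarith
  · exact h5

theorem mono_D (h : NullWave f G S) (hS : ∀ u v, 0 ≤ S u v) {u₁ u₂ v : ℝ} (h1 : -v ≤ u₁)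
    (h12 : u₁ ≤ u₂) (h2 : u₂ ≤ v) : nullD f G u₁ v ≤ nullD f G u₂ v := by
  have := le_sub_of_le_hasDerivAt (c := 0) h12
    (fun x hx => h.derivU x v (by linarith [hx.1])) (fun x hx =>
      mul_nonneg (by linarith [hx.2]) (hS x v))
  linarith

theorem D_nonneg (h : NullWave f G S) (hS : ∀ u v, 0 ≤ S u v) {u v : ℝ} (hv : 1 < v)
    (h1 : -v ≤ u) (h2 : u ≤ v) : 0 ≤ nullD f G u v := by
  have := h.mono_D hS le_rfl h1 h2
  rwa [h.zero_D v hv] at this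

end NullWave

/-- The null form of a free radial wave with data in the unit ball. -/
theorem NullWave.free {f G : ℝ → ℝ → ℝ} (h : NullWave f G (fun _ _ => 0)) {u v w : ℝ}
    (huv : 0 ≤ u + v) (huw : 0 ≤ u + w) (hv : 1 < v) (hw : 1 < w) :
    (v - u) / 2 * f u v = (w - u) / 2 * f u w := by
  have key : ∀ v w : ℝ, 0 ≤ u + v → 1 < v → v ≤ w →
      (v - u) / 2 * f u v = (w - u) / 2 * f u w := by
    intro v w huv hv hvw
    have hD : ∀ x, v ≤ x → nullD f G u x = 0 := fun x hx =>
      h.D_eq_zero (by linarith) (by linarith) fun _ _ _ => rfl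
    have h1 := sub_le_of_hasDerivAt_le (c := 0) hvw
      (fun x _ => h.derivP u x) (fun x hx => (hD x hx.1.le).le)
    have h2 := le_sub_of_le_hasDerivAt (c := 0) hvw
      (fun x _ => h.derivP u x) (fun x hx => (hD x hx.1.le).ge)
    linarith
  rcases le_total v w with hvw | hvw
  · exact key v w huv hv hvw
  · exact (key w v huw hw hvw).symm

theorem NullWave.free_eq_zero {f G : ℝ → ℝ → ℝ} (h : NullWave f G (fun _ _ => 0)) {u v : ℝ}
    (hu : 1 < u) (hv : 1 < v) : (v - u) / 2 * f u v = 0 := by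
  rw [h.free (w := u) (by linarith) (by linarith) hv hu]; simp

/-- A free wave with vanishing radiation field vanishes. -/
theorem NullWave.free_unique {f G : ℝ → ℝ → ℝ} (h : NullWave f G (fun _ _ => 0))
    (h0 : ∀ u ∈ Icc (-2 : ℝ) 2, (4 - u) / 2 * f u 4 = 0) {u v : ℝ} (huv : 0 ≤ u + v)
    (hne : u ≠ v) : f u v = 0 := by
  have hP : ∀ u v, 1 < v → 0 ≤ u + v → (v - u) / 2 * f u v = 0 := by
    intro u v hv huv
    rcases lt_or_ge u (-1) with hu | hu
    · rw [h.exterior (fun _ _ _ _ => rfl) hu huv, mul_zero]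
    rcases lt_or_ge 1 u with hu' | hu'
    · exact h.free_eq_zero hu' hv
    · rw [h.free (w := 4) huv (by linarith) hv (by norm_num)]
      exact h0 u ⟨by linarith, by linarith⟩
  have hP' : ∀ u v, 1 < u → 0 ≤ u + v → (v - u) / 2 * f u v = 0 := by
    intro u v hu huv
    have := hP v u hu (by linarith)
    rw [h.symm]; linarith
  have hDbig : ∀ u v, 1 < u → 0 < u + v → nullD f G u v = 0 := by
    intro u v hu huv
    have h1 : (fun w => (w - u) / 2 * f u w) =ᶠ[nhds v] fun _ => (0 : ℝ) := by
      filter_upwards [lt_mem_nhds (by linarith : -u < v)] with w hw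
      exact hP' u w hu (by linarith)
    exact (h.derivP u v).unique ((hasDerivAt_const v (0 : ℝ)).congr_of_eventuallyEq h1)
  have hD : ∀ u v, 0 ≤ u + v → nullD f G u v = 0 := by
    intro u v huv
    have hle : u ≤ |u| + |v| + 2 := by linarith [le_abs_self u, abs_nonneg v]
    have h1 := sub_le_of_hasDerivAt_le (c := 0) hle
      (fun x hx => h.derivU x v (by linarith [hx.1])) (fun x hx => by simp)
    have h2 := le_sub_of_le_hasDerivAt (c := 0) hle
      (fun x hx => h.derivU x v (by linarith [hx.1])) (fun x hx => by simp)
    have h3 := hDbig (|u| + |v| + 2) v (by linarith [abs_nonneg u, abs_nonneg v])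
      (by linarith [abs_nonneg u, neg_abs_le v])
    linarith
  have hle : v ≤ |u| + |v| + 2 := by linarith [le_abs_self v, abs_nonneg u]
  have h1 := sub_le_of_hasDerivAt_le (c := 0) hle
    (fun x hx => h.derivP u x) (fun x hx => (hD u x (by linarith [hx.1])).le)
  have h2 := le_sub_of_le_hasDerivAt (c := 0) hle
    (fun x hx => h.derivP u x) (fun x hx => (hD u x (by linarith [hx.1])).ge)
  have h3 := hP u (|u| + |v| + 2) (by linarith [abs_nonneg u, abs_nonneg v])
      (by linarith [abs_nonneg v, neg_abs_le u])
  have h4 : (v - u) / 2 * f u v = 0 := by linarith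
  rcases mul_eq_zero.1 h4 with h5 | h5
  · exact absurd (by linarith) hne
  · exact h5

theorem hasDerivAt_integral_sq {h : ℝ → ℝ} (hc : Continuous h) (a x : ℝ) :
    HasDerivAt (fun u => ∫ y in a..u, h y ^ 2) (h x ^ 2) x :=
  (hc.pow 2).integral_hasStrictDerivAt a x |>.hasDerivAt

/-- The first forced wave: `∂_v(r φ₂)` is comparable to `1 / v` inside the cone. -/
theorem exists_D_bounds {f₁ G₁ f₂ G₂ : ℝ → ℝ → ℝ} (h1 : NullWave f₁ G₁ (fun _ _ => 0))
    (h2 : NullWave f₂ G₂ (fun u v => f₁ u v ^ 2))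
    (hne : ∃ u ∈ Icc (-2 : ℝ) 2, (4 - u) / 2 * f₁ u 4 ≠ 0) :
    ∃ K > 0, (∀ u v, 4 ≤ v → 2 ≤ u → u ≤ v → K / (4 * v) ≤ nullD f₂ G₂ u v) ∧
      ∀ u v, 4 ≤ v → -2 ≤ u → u ≤ v → nullD f₂ G₂ u v ≤ K / v := by
  have hS : ∀ u v, 0 ≤ (fun u v => f₁ u v ^ 2) u v := fun u v => sq_nonneg _
  set h : ℝ → ℝ := fun u => (4 - u) / 2 * f₁ u 4 with hh
  have hc : Continuous h := by
    have : Continuous fun u : ℝ => f₁ u 4 :=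
      h1.cont.comp (continuous_id.prodMk continuous_const)
    fun_prop
  have hF : ∀ u v, -2 ≤ u → u ≤ 2 → 4 ≤ v →
      (v - u) / 8 * f₁ u v ^ 2 = h u ^ 2 / (2 * (v - u)) := by
    intro u v hu hu2 hv
    have : h u = (v - u) / 2 * f₁ u v :=
      h1.free (by linarith) (by linarith) (by norm_num) (by linarith)
    rw [this]
    have : v - u ≠ 0 := by linarith
    field_simp
    ring
  have hD0 : ∀ v, 4 ≤ v → nullD f₂ G₂ (-2) v = 0 := fun v hv =>
    h2.D_eq_zero (by linarith) (by linarith) fun w hw hw2 => by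
      have := h1.exterior (fun _ _ _ _ => rfl) (by linarith : w < -1) (by linarith : 0 ≤ w + v)
      simp [this]
  have hK : 0 < ∫ y in (-2 : ℝ)..2, h y ^ 2 := by
    refine intervalIntegral.integral_pos (by norm_num) (hc.pow 2).continuousOn
      (fun x _ => sq_nonneg _) ?_
    obtain ⟨u, hu, hn⟩ := hne
    exact ⟨u, hu, by positivity⟩
  set H : ℝ → ℝ := fun u => ∫ y in (-2 : ℝ)..u, h y ^ 2 with hH
  have hHd : ∀ x, HasDerivAt H (h x ^ 2) x := hasDerivAt_integral_sq hc (-2)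
  have hH0 : H (-2) = 0 := by simp [hH]
  have hlow : ∀ v, 4 ≤ v → H 2 / (4 * v) ≤ nullD f₂ G₂ 2 v := by
    intro v hv
    have := le_sub_of_le_hasDerivAt (c := 0) (F := fun u => nullD f₂ G₂ u v - H u / (4 * v))
      (by norm_num : (-2 : ℝ) ≤ 2)
      (fun x hx => (h2.derivU x v (by linarith [hx.1])).sub ((hHd x).div_const (4 * v)))
      (fun x hx => by
        obtain ⟨hx1, hx2⟩ := hx
        rw [hF x v hx1.le hx2.le hv, sub_nonneg]
        exact div_le_div_of_nonneg_left (sq_nonneg _) (by linarith) (by linarith))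
    simp only [hD0 v hv, hH0, zero_div] at this
    linarith
  have hup : ∀ v, 4 ≤ v → nullD f₂ G₂ 2 v ≤ H 2 / v := by
    intro v hv
    have := sub_le_of_hasDerivAt_le (c := 0) (F := fun u => nullD f₂ G₂ u v - H u / v)
      (by norm_num : (-2 : ℝ) ≤ 2)
      (fun x hx => (h2.derivU x v (by linarith [hx.1])).sub ((hHd x).div_const v))
      (fun x hx => by
        obtain ⟨hx1, hx2⟩ := hx
        rw [hF x v hx1.le hx2.le hv, sub_nonpos]
        exact div_le_div_of_nonneg_left (sq_nonneg _) (by linarith) (by linarith))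
    simp only [hD0 v hv, hH0, zero_div] at this
    linarith
  refine ⟨H 2, hK, fun u v hv hu huv => (hlow v hv).trans
    (h2.mono_D hS (by linarith) hu huv), fun u v hv hu huv => ?_⟩
  rcases le_total u 2 with hu2 | hu2
  · exact (h2.mono_D hS (by linarith) hu2 (by linarith)).trans (hup v hv)
  · have := sub_le_of_hasDerivAt_le (c := 0) hu2
      (fun x hx => h2.derivU x v (by linarith [hx.1])) (fun x hx => by
        have := h1.free_eq_zero (by linarith [hx.1] : 1 < x) (by linarith : 1 < v)
        have h3 : (v - x) / 8 * f₁ x v ^ 2 = ((v - x) / 2 * f₁ x v) * f₁ x v / 4 := by ring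
        simp only [h3, this]; simp)
    linarith [hup v hv]

/-- Growth of the second wave: `r φ₂` is bounded below in the interior, bounded above by a
logarithm, and vanishes linearly at the axis. -/
theorem exists_P_bounds {f G S : ℝ → ℝ → ℝ} (h : NullWave f G S) (hS : ∀ u v, 0 ≤ S u v)
    {K : ℝ} (hK : 0 < K)
    (hlow : ∀ u v, 4 ≤ v → 2 ≤ u → u ≤ v → K / (4 * v) ≤ nullD f G u v)
    (hup : ∀ u v, 4 ≤ v → -2 ≤ u → u ≤ v → nullD f G u v ≤ K / v) :
    (∀ u v, 4 ≤ u → u ≤ v / 2 → K / 8 ≤ (v - u) / 2 * f u v) ∧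
    (∀ u v, 4 ≤ u → u ≤ v → |(v - u) / 2 * f u v| ≤ K / u * (v - u)) ∧
    ∃ C ≥ 0, ∀ u v, 4 ≤ v → -2 ≤ u → u ≤ v → |(v - u) / 2 * f u v| ≤ C + K * log v := by
  have hnn : ∀ u v, 4 ≤ v → -2 ≤ u → u ≤ v → 0 ≤ nullD f G u v := fun u v hv hu huv =>
    h.D_nonneg hS (by linarith) (by linarith) huv
  have hax : ∀ u v, 4 ≤ u → u ≤ v → 0 ≤ (v - u) / 2 * f u v := fun u v hu huv => by
    have := le_sub_of_le_hasDerivAt (c := 0) huv (fun x _ => h.derivP u x)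
      (fun x hx => hnn u x (by linarith [hx.1]) (by linarith) hx.1.le)
    simpa using this
  have hlog : ∀ u a v, 4 ≤ a → -2 ≤ u → u ≤ a → a ≤ v →
      (v - u) / 2 * f u v - (a - u) / 2 * f u a ≤ K * log v := fun u a v ha hu hua hav => by
    have := sub_le_of_hasDerivAt_le (c := 0) (F := fun x => (x - u) / 2 * f u x - K * log x) hav
      (fun x hx => (h.derivP u x).sub
        ((hasDerivAt_log (by linarith [hx.1] : x ≠ 0)).const_mul K))
      (fun x hx => by
        have := hup u x (by linarith [hx.1]) hu (by linarith [hx.1])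
        rw [div_eq_mul_inv] at this
        linarith)
    have h0 : 0 ≤ K * log a := mul_nonneg hK.le (log_nonneg (by linarith))
    linarith
  refine ⟨fun u v hu huv => ?_, fun u v hu huv => ?_, ?_⟩
  · have h1 := le_sub_of_le_hasDerivAt (c := K / (4 * v)) (by linarith : v / 2 ≤ v)
      (fun x _ => h.derivP u x)
      (fun x hx => (div_le_div_of_nonneg_left hK.le (by linarith [hx.1])
        (by linarith [hx.2])).trans
          (hlow u x (by linarith [hx.1]) (by linarith) (by linarith [hx.1])))
    have h2 := hax u (v / 2) hu huv
    have h3 : K / (4 * v) * (v - v / 2) = K / 8 := by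
      have : v ≠ 0 := by linarith
      field_simp; norm_num
    linarith
  · rw [abs_of_nonneg (hax u v hu huv)]
    have := sub_le_of_hasDerivAt_le (c := K / u) huv (fun x _ => h.derivP u x)
      (fun x hx => (hup u x (by linarith [hx.1]) (by linarith) hx.1.le).trans
        (div_le_div_of_nonneg_left hK.le (by linarith) hx.1.le))
    simpa using this
  · have hc : Continuous fun u : ℝ => (4 - u) / 2 * f u 4 := by
      have : Continuous fun u : ℝ => f u 4 :=
        h.cont.comp (continuous_id.prodMk continuous_const)
      fun_prop
    obtain ⟨C, hC⟩ := (isCompact_Icc (a := (-2 : ℝ)) (b := 4)).exists_bound_of_continuousOn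
      hc.continuousOn
    refine ⟨|C|, abs_nonneg C, fun u v hv hu huv => ?_⟩
    rcases le_total u 4 with h4 | h4
    · have h1 := hlog u 4 v le_rfl hu h4 hv
      have h2 := le_sub_of_le_hasDerivAt (c := 0) hv (fun x _ => h.derivP u x)
        (fun x hx => hnn u x hx.1.le hu (by linarith [hx.1]))
      have h3 := abs_le.1 ((hC u ⟨hu, h4⟩).trans (le_abs_self C))
      have h0 : 0 ≤ K * log v := mul_nonneg hK.le (log_nonneg (by linarith))
      rw [abs_le]
      constructor <;> linarith [h3.1, h3.2]
    · rw [abs_of_nonneg (hax u v h4 huv)]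
      have := hlog u u v h4 hu le_rfl huv
      simp only [sub_self, zero_div, zero_mul, sub_zero] at this
      linarith [abs_nonneg C]

/-- The third wave is bounded below in the interior of the cone. -/
theorem exists_lower_bound {f₂ f G : ℝ → ℝ → ℝ} (h : NullWave f G (fun u v => f₂ u v ^ 2))
    {k : ℝ} (hk : 0 < k) (hlow : ∀ u v, 4 ≤ u → u ≤ v / 2 → k ≤ (v - u) / 2 * f₂ u v) :
    ∃ c > 0, ∀ u v, 32 ≤ u → v / 4 ≤ u → u < v → c ≤ f u v := by
  have hS : ∀ u v, 0 ≤ (fun u v => f₂ u v ^ 2) u v := fun u v => sq_nonneg _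
  have hD : ∀ u v, 32 ≤ v → v / 4 ≤ u → u ≤ v → k ^ 2 / 16 ≤ nullD f G u v := by
    intro u v hv hu huv
    have h1 := le_sub_of_le_hasDerivAt (c := k ^ 2 / (2 * v)) (by linarith : 4 ≤ v / 4)
      (fun x hx => h.derivU x v (by linarith [hx.1])) (fun x hx => by
        obtain ⟨hx1, hx2⟩ := hx
        have hP := hlow x v hx1.le (by linarith)
        have hne : v - x ≠ 0 := by linarith
        have : (v - x) / 8 * f₂ x v ^ 2 = ((v - x) / 2 * f₂ x v) ^ 2 / (2 * (v - x)) := by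
          field_simp; ring
        rw [this]
        have h0 : 0 < v - x := by linarith
        gcongr
        linarith)
    have h2 := h.D_nonneg hS (by linarith : 1 < v) (by linarith : -v ≤ 4) (by linarith)
    have h3 := h.mono_D hS (by linarith : -v ≤ v / 4) hu huv
    have h4 : k ^ 2 / (2 * v) * (v / 8) = k ^ 2 / 16 := by
      have : v ≠ 0 := by linarith
      field_simp; norm_num
    have h5 : k ^ 2 / (2 * v) * (v / 8) ≤ k ^ 2 / (2 * v) * (v / 4 - 4) := by
      gcongr; linarith
    linarith
  refine ⟨k ^ 2 / 8, by positivity, fun u v hu hvu huv => ?_⟩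
  have h1 := le_sub_of_le_hasDerivAt (c := k ^ 2 / 16) huv.le (fun x _ => h.derivP u x)
    (fun x hx => hD u x (by linarith [hx.1]) (by linarith [hx.2]) hx.1.le)
  have h2 : 0 ≤ (f u v - k ^ 2 / 8) * (v - u) := by
    simp only [sub_self, zero_div, zero_mul, sub_zero] at h1
    linarith
  have := nonneg_of_mul_nonneg_left h2 (by linarith)
  linarith

/-- The third wave grows at most polylogarithmically near the axis. -/
theorem upper_bound_near_axis {f₂ f G : ℝ → ℝ → ℝ} (h : NullWave f G (fun u v => f₂ u v ^ 2))
    (hS0 : ∀ u v, u < -1 → 0 ≤ u + v → f₂ u v = 0) {K C : ℝ} (hK : 0 < K) (hC : 0 ≤ C)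
    (hlin : ∀ u v, 4 ≤ u → u ≤ v → |(v - u) / 2 * f₂ u v| ≤ K / u * (v - u))
    (hlog : ∀ u v, 4 ≤ v → -2 ≤ u → u ≤ v → |(v - u) / 2 * f₂ u v| ≤ C + K * log v)
    {u v : ℝ} (hu : 8 ≤ u) (huv : u < v) :
    |f u v| ≤ 2 * ((C + K * log v) ^ 2 + K ^ 2) := by
  have hS : ∀ u v, 0 ≤ (fun u v => f₂ u v ^ 2) u v := fun u v => sq_nonneg _
  have hF : ∀ u v, u < v →
      (v - u) / 8 * f₂ u v ^ 2 = |(v - u) / 2 * f₂ u v| ^ 2 / (2 * (v - u)) := by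
    intro u v huv
    have hne : v - u ≠ 0 := by linarith
    rw [sq_abs]
    field_simp; ring
  have hD : ∀ u v, 8 ≤ v → -2 ≤ u → u ≤ v →
      nullD f G u v ≤ (C + K * log v) ^ 2 + K ^ 2 := by
    intro u v hv hu huv
    have h1 := h.mono_D hS (by linarith) huv le_rfl
    have h0 : nullD f G (-2) v = 0 := h.D_eq_zero (by linarith) (by linarith) fun w hw hw2 => by
      simp [hS0 w v (by linarith) (by linarith)]
    have h2 := sub_le_of_hasDerivAt_le (c := (C + K * log v) ^ 2 / v)
      (by linarith : -2 ≤ v / 2)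
      (fun x hx => h.derivU x v (by linarith [hx.1])) (fun x hx => by
        obtain ⟨hx1, hx2⟩ := hx
        rw [hF x v (by linarith)]
        have := hlog x v (by linarith) hx1.le (by linarith)
        gcongr
        linarith)
    have h3 := sub_le_of_hasDerivAt_le (c := 2 * K ^ 2 / v)
      (by linarith : v / 2 ≤ v)
      (fun x hx => h.derivU x v (by linarith [hx.1])) (fun x hx => by
        obtain ⟨hx1, hx2⟩ := hx
        rw [hF x v (by linarith)]
        have h4 := hlin x v (by linarith) (by linarith)
        have h5 : 0 < v - x := by linarith
        have h6 : 0 < v := by linarith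
        have h7 : |(v - x) / 2 * f₂ x v| ≤ 2 * K / v * (v - x) := by
          refine h4.trans ?_
          gcongr ?_ * _
          rw [div_le_div_iff₀ (by linarith) h6]
          nlinarith
        calc |(v - x) / 2 * f₂ x v| ^ 2 / (2 * (v - x))
            ≤ (2 * K / v * (v - x)) ^ 2 / (2 * (v - x)) := by gcongr
          _ = 2 * K ^ 2 / v * ((v - x) / v) := by field_simp
          _ ≤ 2 * K ^ 2 / v * 1 := by
            gcongr
            rw [div_le_one h6]; linarith
          _ = 2 * K ^ 2 / v := mul_one _)
    have hv0 : v ≠ 0 := by linarith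
    have h4 : (C + K * log v) ^ 2 / v * (v / 2 - -2) ≤ (C + K * log v) ^ 2 / v * v := by
      have : 0 < v := by linarith
      gcongr; linarith
    rw [div_mul_cancel₀ _ hv0] at h4
    have h5 : 2 * K ^ 2 / v * (v - v / 2) = K ^ 2 := by field_simp; norm_num
    linarith
  have h1 := sub_le_of_hasDerivAt_le (c := (C + K * log v) ^ 2 + K ^ 2) huv.le
    (fun x _ => h.derivP u x) (fun x hx => by
      obtain ⟨hx1, hx2⟩ := hx
      refine (hD u x (by linarith) (by linarith) hx1.le).trans ?_
      have : 0 ≤ log x := log_nonneg (by linarith)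
      have : log x ≤ log v := log_le_log (by linarith) hx2.le
      gcongr)
  have h2 := le_sub_of_le_hasDerivAt (c := 0) huv.le (fun x _ => h.derivP u x)
    (fun x hx => h.D_nonneg hS (by linarith [hx.1]) (by linarith [hx.1]) hx.1.le)
  simp only [sub_self, zero_div, zero_mul, sub_zero] at h1 h2
  have h3 : 0 < v - u := by linarith
  have h4 : 0 ≤ f u v := by
    have : 0 < (v - u) / 2 := by linarith
    exact nonneg_of_mul_nonneg_right h2 this
  rw [abs_of_nonneg h4]
  have h5 : 0 ≤ (2 * ((C + K * log v) ^ 2 + K ^ 2) - f u v) * (v - u) := by linarith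
  have := nonneg_of_mul_nonneg_left h5 h3
  linarith

/-- A quadratic lower bound is incompatible with increments of size `√n`. -/
theorem false_of_quadratic_growth {a : ℝ → ℝ} {c M : ℝ} (hc : 0 < c) (hM : 0 ≤ M)
    (hlow : ∀ v, 256 ≤ v → c * v ^ 2 ≤ a v)
    (hinc : ∀ v, 256 ≤ v → a (v + 1) - a v ≤ M * √(v + 1)) : False := by
  have hsum : ∀ n : ℕ, a (256 + n) ≤ a 256 + n * (M * √(256 + n)) := by
    intro n
    induction n with
    | zero => simp
    | succ n ih =>
      have h1 := hinc (256 + n) (by linarith [(Nat.cast_nonneg n : (0 : ℝ) ≤ n)])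
      push_cast
      have h2 : √(256 + (n : ℝ)) ≤ √(256 + n + 1) := Real.sqrt_le_sqrt (by linarith)
      have h3 : n * (M * √(256 + (n : ℝ))) ≤ n * (M * √(256 + n + 1)) := by gcongr
      rw [← add_assoc]
      linarith
  obtain ⟨n, hn⟩ := exists_nat_gt (((|a 256| + M) / c) ^ 2)
  set s := √(256 + (n : ℝ)) with hs
  have hn0 : (0 : ℝ) ≤ n := Nat.cast_nonneg n
  have hs2 : s ^ 2 = 256 + n := Real.sq_sqrt (by linarith)
  have hs0 : 0 ≤ s := Real.sqrt_nonneg _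
  have hs1 : 1 ≤ s := by nlinarith
  have hlt : (|a 256| + M) / c < s := by
    apply lt_of_pow_lt_pow_left₀ 2 hs0
    linarith
  rw [div_lt_iff₀ hc] at hlt
  have h1 := hsum n
  have h2 := hlow (256 + n) (by linarith)
  have h3 : c * (s ^ 2) ^ 2 ≤ |a 256| + s ^ 2 * (M * s) := by
    rw [hs2]
    have : (n : ℝ) * (M * s) ≤ (256 + n) * (M * s) := by gcongr; linarith
    linarith [le_abs_self (a 256)]
  have h4 : |a 256| ≤ |a 256| * s ^ 3 := le_mul_of_one_le_right (abs_nonneg _) (one_le_pow₀ hs1)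
  have h5 : (|a 256| + M) * s ^ 3 < s * c * s ^ 3 := by gcongr
  nlinarith

/-- A radial cascade of four null waves with nontrivial first component cannot have its last
component of outgoing slope at most one. -/
theorem cascade_false {f₁ G₁ f₂ G₂ f₃ G₃ f₄ G₄ : ℝ → ℝ → ℝ}
    (h1 : NullWave f₁ G₁ (fun _ _ => 0)) (h2 : NullWave f₂ G₂ (fun u v => f₁ u v ^ 2))
    (h3 : NullWave f₃ G₃ (fun u v => f₂ u v ^ 2)) (h4 : NullWave f₄ G₄ (fun u v => f₃ u v ^ 2))
    (hne : ∃ u ∈ Icc (-2 : ℝ) 2, (4 - u) / 2 * f₁ u 4 ≠ 0)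
    (hG : ∀ u v, 0 ≤ u + v → u < v → |G₄ u v| ≤ 1 / 2) : False := by
  have hS1 : ∀ u v, 0 ≤ (fun u v => f₁ u v ^ 2) u v := fun u v => sq_nonneg _
  have hS3 : ∀ u v, 0 ≤ (fun u v => f₃ u v ^ 2) u v := fun u v => sq_nonneg _
  obtain ⟨K, hK, hlow, hup⟩ := exists_D_bounds h1 h2 hne
  obtain ⟨hP, hlin, C, hC, hlog⟩ := exists_P_bounds h2 hS1 hK hlow hup
  obtain ⟨c, hc, hf3⟩ := exists_lower_bound h3 (by positivity : 0 < K / 8) hP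
  have hz1 : ∀ u v, u < -1 → 0 ≤ u + v → f₁ u v = 0 := fun u v hu huv =>
    h1.exterior (fun _ _ _ _ => rfl) hu huv
  have hz2 : ∀ u v, u < -1 → 0 ≤ u + v → f₂ u v = 0 := fun u v hu huv =>
    h2.exterior (fun u v hu huv => by simp [hz1 u v hu huv]) hu huv
  have hup3 : ∀ u v, 8 ≤ u → u < v → |f₃ u v| ≤ 2 * ((C + K * log v) ^ 2 + K ^ 2) :=
    fun u v hu huv => upper_bound_near_axis h3 hz2 hK hC hlin hlog hu huv
  set B := C + K * 8 with hB
  have hB0 : 0 ≤ B := by positivity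
  have hup3' : ∀ u v, 8 ≤ u → u < v → f₃ u v ^ 2 ≤ 4 * (B ^ 2 + K ^ 2) ^ 2 * √v := by
    intro u v hu huv
    have hv1 : 1 ≤ v := by linarith
    set w := v ^ (1 / 8 : ℝ) with hw
    have hw1 : 1 ≤ w := Real.one_le_rpow hv1 (by norm_num)
    have hw4 : w ^ 4 = √v := by
      rw [hw, Real.sqrt_eq_rpow, ← Real.rpow_natCast, ← Real.rpow_mul (by linarith)]
      norm_num
    have hl : log v ≤ 8 * w := by
      have := Real.log_le_rpow_div (by linarith : 0 ≤ v) (by norm_num : (0 : ℝ) < 1 / 8)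
      rw [← hw] at this; linarith
    have hl0 : 0 ≤ log v := log_nonneg hv1
    have hb : C + K * log v ≤ B * w := by
      have h5 : C ≤ C * w := le_mul_of_one_le_right hC hw1
      have h6 : K * log v ≤ K * (8 * w) := by gcongr
      rw [hB]; linarith
    have hb0 : 0 ≤ C + K * log v := by positivity
    have hq : (C + K * log v) ^ 2 + K ^ 2 ≤ (B ^ 2 + K ^ 2) * w ^ 2 := by
      have h5 : (C + K * log v) ^ 2 ≤ (B * w) ^ 2 := by gcongr
      have h6 : K ^ 2 ≤ K ^ 2 * w ^ 2 :=
        le_mul_of_one_le_right (sq_nonneg _) (one_le_pow₀ hw1)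
      linarith [mul_pow B w 2]
    have h5 : |f₃ u v| ≤ 2 * ((B ^ 2 + K ^ 2) * w ^ 2) := (hup3 u v hu huv).trans (by linarith)
    calc f₃ u v ^ 2 = |f₃ u v| ^ 2 := (sq_abs _).symm
      _ ≤ (2 * ((B ^ 2 + K ^ 2) * w ^ 2)) ^ 2 := by gcongr
      _ = 4 * (B ^ 2 + K ^ 2) ^ 2 * w ^ 4 := by ring
      _ = _ := by rw [hw4]
  refine false_of_quadratic_growth (a := fun v => nullD f₄ G₄ v v) (c := c ^ 2 / 64)
    (M := (B ^ 2 + K ^ 2) ^ 2 / 2 + 1) (by positivity) (by positivity) ?_ ?_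
  · intro v hv
    have h5 := le_sub_of_le_hasDerivAt (c := v / 16 * c ^ 2) (by linarith : v / 4 ≤ v / 2)
      (fun x hx => h4.derivU x v (by linarith [hx.1])) (fun x hx => by
        obtain ⟨hx1, hx2⟩ := hx
        have := hf3 x v (by linarith) hx1.le (by linarith)
        have h6 : v / 16 ≤ (v - x) / 8 := by linarith
        have h7 : 0 ≤ (v - x) / 8 := by linarith
        gcongr)
    have h6 := h4.D_nonneg hS3 (by linarith : 1 < v) (by linarith : -v ≤ v / 4) (by linarith)
    have h7 := h4.mono_D hS3 (by linarith : -v ≤ v / 2) (by linarith : v / 2 ≤ v) le_rfl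
    show _ ≤ nullD f₄ G₄ v v
    linarith
  · intro u hu
    have h5 := sub_le_of_hasDerivAt_le (c := (B ^ 2 + K ^ 2) ^ 2 / 2 * √(u + 1))
      (by linarith : u ≤ u + 1)
      (fun x hx => h4.derivU x (u + 1) (by linarith [hx.1])) (fun x hx => by
        obtain ⟨hx1, hx2⟩ := hx
        have h6 := hup3' x (u + 1) (by linarith) hx2
        calc (u + 1 - x) / 8 * f₃ x (u + 1) ^ 2
            ≤ 1 / 8 * (4 * (B ^ 2 + K ^ 2) ^ 2 * √(u + 1)) := by
              gcongr; linarith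
          _ = _ := by ring)
    have h6 := sub_le_of_hasDerivAt_le (c := 1 / 2) (by linarith : u ≤ u + 1)
      (fun x _ => h4.derivV u x)
      (fun x hx => (abs_le.1 (hG u x (by linarith [hx.1]) hx.1)).2)
    have h7 := (abs_le.1 (hG u (u + 1) (by linarith) (by linarith))).2
    have h8 : 1 ≤ √(u + 1) := Real.one_le_sqrt.2 (by linarith)
    have h9 : nullD f₄ G₄ u u = f₄ u u / 2 := by simp [nullD]
    have h10 : nullD f₄ G₄ u (u + 1) = f₄ u (u + 1) / 2 + 1 / 2 * G₄ u (u + 1) := by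
      simp [nullD]
    show nullD f₄ G₄ (u + 1) (u + 1) - nullD f₄ G₄ u u ≤ _
    linarith

theorem hasDerivAt_comp_pair {h : ℝ × ℝ → ℝ} (hh : Differentiable ℝ h) {t r : ℝ → ℝ}
    {t' r' s : ℝ} (ht : HasDerivAt t t' s) (hr : HasDerivAt r r' s) :
    HasDerivAt (fun s => h (t s, r s))
      (t' * fderiv ℝ h (t s, r s) (1, 0) + r' * fderiv ℝ h (t s, r s) (0, 1)) s := by
  have h1 := (hh (t s, r s)).hasFDerivAt.comp_hasDerivAt s (ht.prodMk hr)
  refine h1.congr_deriv ?_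
  have : ((t', r') : ℝ × ℝ) = t' • ((1 : ℝ), (0 : ℝ)) + r' • ((0 : ℝ), (1 : ℝ)) := by simp
  rw [this, map_add, map_smul, map_smul, smul_eq_mul, smul_eq_mul]

/-- The first coordinate vector. -/
def axisVec : E3 := EuclideanSpace.single 0 1

theorem norm_axisVec : ‖axisVec‖ = 1 := by simp [axisVec]

theorem norm_smul_axisVec_add (r s : ℝ) {i : Fin 3} (hi : i ≠ 0) :
    ‖r • axisVec + s • (EuclideanSpace.single i (1 : ℝ) : E3)‖ = √(r ^ 2 + s ^ 2) := by
  rw [EuclideanSpace.norm_eq]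
  congr 1
  fin_cases i
  · exact absurd rfl hi
  all_goals simp [Fin.sum_univ_three, axisVec]

theorem Radial.neg_axis {F : E3 → ℝ} (hF : Radial F) (r : ℝ) :
    F ((-r) • axisVec) = F (r • axisVec) := hF _ _ (by simp [norm_smul])

theorem Radial.eq_axis {F : E3 → ℝ} (hF : Radial F) (x : E3) : F x = F (‖x‖ • axisVec) :=
  hF _ _ (by simp [norm_smul, norm_axisVec])

/-- The Laplacian of a radial function. -/
theorem lap3_radial {F : E3 → ℝ} (hF : Radial F) {k' k'' : ℝ → ℝ}
    (h1 : ∀ r, HasDerivAt (fun r : ℝ => F (r • axisVec)) (k' r) r)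
    (h2 : ∀ r, HasDerivAt k' (k'' r) r) {r : ℝ} (hr : r ≠ 0) :
    lap3 F (r • axisVec) = k'' r + 2 * k' r / r := by
  have hodd : k' (-r) = - k' r := by
    have h3 := (h1 (-r)).scomp r (hasDerivAt_neg r)
    have h4 : ((fun r : ℝ => F (r • axisVec)) ∘ Neg.neg) = fun r : ℝ => F (r • axisVec) := by
      funext s; exact hF.neg_axis s
    rw [h4] at h3
    have := h3.unique (h1 r)
    simp at this
    linarith
  have habs : k' |r| / |r| = k' r / r := by
    rcases abs_choice r with h | h <;> rw [h]
    rw [hodd, neg_div_neg_eq]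
  have hax : ∀ s : ℝ, pX 0 F (s • axisVec) = k' s := by
    intro s
    have h3 : (fun h : ℝ => F (s • axisVec + h • (EuclideanSpace.single 0 (1 : ℝ)))) =
        fun h : ℝ => F ((h + s) • axisVec) := by
      funext h
      rw [add_comm h s, add_smul]; rfl
    rw [pX, h3]
    have := HasDerivAt.comp_add_const (f := fun r : ℝ => F (r • axisVec)) 0 s (by simpa using h1 s)
    exact this.deriv
  have h00 : pX 0 (pX 0 F) (r • axisVec) = k'' r := by
    have h3 : (fun h : ℝ => pX 0 F (r • axisVec + h • (EuclideanSpace.single 0 (1 : ℝ)))) =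
        fun h : ℝ => k' (h + r) := by
      funext h
      rw [← hax, add_comm h r, add_smul]; rfl
    rw [pX, h3]
    have := HasDerivAt.comp_add_const (f := k') 0 r (by simpa using h2 r)
    exact this.deriv
  have hq : ∀ s, 0 < r ^ 2 + s ^ 2 := fun s => by positivity
  have hsq : ∀ s, HasDerivAt (fun s => √(r ^ 2 + s ^ 2)) (s / √(r ^ 2 + s ^ 2)) s := by
    intro s
    have h3 : HasDerivAt (fun s => r ^ 2 + s ^ 2) (2 * s) s := by
      simpa using ((hasDerivAt_id s).pow 2).const_add (r ^ 2)
    refine (h3.sqrt (hq s).ne').congr_deriv ?_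
    have := (Real.sqrt_pos.2 (hq s)).ne'
    field_simp
  have hi : ∀ i : Fin 3, i ≠ 0 → pX i (pX i F) (r • axisVec) = k' r / r := by
    intro i hi
    have h3 : ∀ s : ℝ, F (r • axisVec + s • (EuclideanSpace.single i (1 : ℝ))) =
        F (√(r ^ 2 + s ^ 2) • axisVec) := by
      intro s
      rw [hF.eq_axis, norm_smul_axisVec_add r s hi]
    have h4 : ∀ s : ℝ, pX i F (r • axisVec + s • (EuclideanSpace.single i (1 : ℝ))) =
        s * (k' (√(r ^ 2 + s ^ 2)) / √(r ^ 2 + s ^ 2)) := by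
      intro s
      have h5 : (fun h : ℝ => F (r • axisVec + s • (EuclideanSpace.single i (1 : ℝ)) +
          h • (EuclideanSpace.single i (1 : ℝ)))) =
          fun h : ℝ => F (√(r ^ 2 + (h + s) ^ 2) • axisVec) := by
        funext h
        rw [← h3, add_comm h s, add_smul, add_assoc]
      rw [pX, h5]
      have h6 : HasDerivAt (fun s : ℝ => F (√(r ^ 2 + s ^ 2) • axisVec))
          (s / √(r ^ 2 + s ^ 2) * k' (√(r ^ 2 + s ^ 2))) s :=
        (HasDerivAt.comp (h₂ := fun r : ℝ => F (r • axisVec)) s (h1 _) (hsq s)).congr_deriv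
          (mul_comm _ _)
      have := HasDerivAt.comp_add_const
        (f := fun s : ℝ => F (√(r ^ 2 + s ^ 2) • axisVec)) 0 s (by simpa using h6)
      rw [this.deriv]
      ring
    rw [pX, funext h4]
    have h7 : HasDerivAt (fun s => k' (√(r ^ 2 + s ^ 2)))
        (0 / √(r ^ 2 + 0 ^ 2) * k'' (√(r ^ 2 + 0 ^ 2))) 0 :=
      (h2 _).scomp 0 (hsq 0)
    have h8 := (hasDerivAt_id (0 : ℝ)).mul (h7.div (hsq 0) (Real.sqrt_pos.2 (hq 0)).ne')
    refine h8.deriv.trans ?_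
    rw [← habs, ← Real.sqrt_sq_eq_abs]
    simp
  rw [lap3, Fin.sum_univ_three, h00, hi 1 (by decide), hi 2 (by decide)]
  ring

/-- The profile of a radial function of `(t, x)`. -/
def profile (φ : ℝ → E3 → ℝ) (p : ℝ × ℝ) : ℝ := φ p.1 (p.2 • axisVec)

/-- The profile in null coordinates. -/
def nullF (φ : ℝ → E3 → ℝ) (u v : ℝ) : ℝ := profile φ ((u + v) / 2, (v - u) / 2)

/-- The `v`-derivative of the profile in null coordinates. -/
def nullG (φ : ℝ → E3 → ℝ) (u v : ℝ) : ℝ :=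
  (fderiv ℝ (profile φ) ((u + v) / 2, (v - u) / 2) (1, 0) +
    fderiv ℝ (profile φ) ((u + v) / 2, (v - u) / 2) (0, 1)) / 2

theorem contDiff_profile {φ : ℝ → E3 → ℝ}
    (hφ : ContDiff ℝ (⊤ : ℕ∞) (fun p : ℝ × E3 => φ p.1 p.2)) : ContDiff ℝ (⊤ : ℕ∞) (profile φ) :=
  hφ.comp (contDiff_fst.prodMk (contDiff_snd.smul contDiff_const))

theorem contDiff_fderiv_profile {φ : ℝ → E3 → ℝ}
    (hφ : ContDiff ℝ (⊤ : ℕ∞) (fun p : ℝ × E3 => φ p.1 p.2)) (w : ℝ × ℝ) :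
    ContDiff ℝ (⊤ : ℕ∞) (fun p => fderiv ℝ (profile φ) p w) :=
  ((contDiff_profile hφ).fderiv_right (by simp)).clm_apply contDiff_const

theorem dtP_profile {φ : ℝ → E3 → ℝ}
    (hφ : ContDiff ℝ (⊤ : ℕ∞) (fun p : ℝ × E3 => φ p.1 p.2)) (t r : ℝ) :
    dtP φ t (r • axisVec) = fderiv ℝ (profile φ) (t, r) (1, 0) := by
  have := hasDerivAt_comp_pair ((contDiff_profile hφ).differentiable (by simp))
    (hasDerivAt_id t) (hasDerivAt_const t r)
  have h2 := this.deriv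
  simp only [id, one_mul, zero_mul, add_zero] at h2
  exact h2

theorem dtP_dtP_profile {φ : ℝ → E3 → ℝ}
    (hφ : ContDiff ℝ (⊤ : ℕ∞) (fun p : ℝ × E3 => φ p.1 p.2))
    (t r : ℝ) : dtP (dtP φ) t (r • axisVec) =
    fderiv ℝ (fun p => fderiv ℝ (profile φ) p (1, 0)) (t, r) (1, 0) := by
  have := hasDerivAt_comp_pair ((contDiff_fderiv_profile hφ (1, 0)).differentiable (by simp))
    (hasDerivAt_id t) (hasDerivAt_const t r)
  have h2 := this.deriv
  simp only [id, one_mul, zero_mul, add_zero] at h2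
  rw [← h2, dtP]
  simp only [dtP_profile hφ]

theorem hasDerivAt_profile_snd {φ : ℝ → E3 → ℝ}
    (hφ : ContDiff ℝ (⊤ : ℕ∞) (fun p : ℝ × E3 => φ p.1 p.2))
    (t r : ℝ) : HasDerivAt (fun r => profile φ (t, r))
    (fderiv ℝ (profile φ) (t, r) (0, 1)) r := by
  have := hasDerivAt_comp_pair ((contDiff_profile hφ).differentiable (by simp))
    (hasDerivAt_const r t) (hasDerivAt_id r)
  simpa using this

theorem dvNull_profile {φ : ℝ → E3 → ℝ}
    (hφ : ContDiff ℝ (⊤ : ℕ∞) (fun p : ℝ × E3 => φ p.1 p.2))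
    (t : ℝ) {r : ℝ} (hr : 0 < r) : dvNull φ t (r • axisVec) =
    fderiv ℝ (profile φ) (t, r) (1, 0) + fderiv ℝ (profile φ) (t, r) (0, 1) := by
  rw [dvNull, dtP_profile hφ]
  congr 1
  have h1 : ‖r • axisVec‖⁻¹ • r • axisVec = axisVec := by
    rw [norm_smul, norm_axisVec, mul_one, Real.norm_of_nonneg hr.le, smul_smul,
      inv_mul_cancel₀ hr.ne', one_smul]
  rw [h1]
  have h2 : (fun ρ : ℝ => φ t (r • axisVec + ρ • axisVec)) = fun ρ => profile φ (t, ρ + r) := by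
    funext ρ
    rw [profile, add_comm ρ r, add_smul]
  rw [h2]
  exact (HasDerivAt.comp_add_const (f := fun r => profile φ (t, r)) 0 r
    (by simpa using hasDerivAt_profile_snd hφ t r)).deriv

theorem hasDerivAt_nullF {φ : ℝ → E3 → ℝ}
    (hφ : ContDiff ℝ (⊤ : ℕ∞) (fun p : ℝ × E3 => φ p.1 p.2))
    (u v : ℝ) : HasDerivAt (fun w => nullF φ u w) (nullG φ u v) v := by
  have h1 : HasDerivAt (fun w : ℝ => (u + w) / 2) (1 / 2) v :=
    ((hasDerivAt_id v).const_add u).div_const 2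
  have h2 : HasDerivAt (fun w : ℝ => (w - u) / 2) (1 / 2) v :=
    ((hasDerivAt_id v).sub_const u).div_const 2
  refine (hasDerivAt_comp_pair ((contDiff_profile hφ).differentiable (by simp)) h1 h2).congr_deriv ?_
  rw [nullG]; ring

theorem box_profile {φ : ℝ → E3 → ℝ}
    (hφ : ContDiff ℝ (⊤ : ℕ∞) (fun p : ℝ × E3 => φ p.1 p.2))
    (hrad : ∀ t, Radial (φ t)) (t : ℝ) {r : ℝ} (hr : r ≠ 0) :
    box φ t (r • axisVec) =
      fderiv ℝ (fun p => fderiv ℝ (profile φ) p (1, 0)) (t, r) (1, 0) -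
      (fderiv ℝ (fun p => fderiv ℝ (profile φ) p (0, 1)) (t, r) (0, 1) +
        2 * fderiv ℝ (profile φ) (t, r) (0, 1) / r) := by
  rw [box, dtP_dtP_profile hφ]
  congr 1
  refine lap3_radial (hrad t) (k' := fun r => fderiv ℝ (profile φ) (t, r) (0, 1))
    (k'' := fun r => fderiv ℝ (fun p => fderiv ℝ (profile φ) p (0, 1)) (t, r) (0, 1))
    (fun r => hasDerivAt_profile_snd hφ t r) (fun r => ?_) hr
  have := hasDerivAt_comp_pair ((contDiff_fderiv_profile hφ (0, 1)).differentiable (by simp))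
    (hasDerivAt_const r t) (hasDerivAt_id r)
  simpa using this

theorem fderiv_profile_symm {φ : ℝ → E3 → ℝ}
    (hφ : ContDiff ℝ (⊤ : ℕ∞) (fun p : ℝ × E3 => φ p.1 p.2)) (p : ℝ × ℝ) :
    fderiv ℝ (fun p => fderiv ℝ (profile φ) p (1, 0)) p (0, 1) =
      fderiv ℝ (fun p => fderiv ℝ (profile φ) p (0, 1)) p (1, 0) := by
  have hd : DifferentiableAt ℝ (fderiv ℝ (profile φ)) p :=
    (((contDiff_profile hφ).fderiv_right (m := (⊤ : ℕ∞)) (by simp)).differentiable (by simp)) p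
  have hs : IsSymmSndFDerivAt ℝ (profile φ) p :=
    (contDiff_profile hφ).contDiffAt.isSymmSndFDerivAt (by
      rw [minSmoothness_of_isRCLikeNormedField]; exact WithTop.coe_le_coe.2 (le_top : (2 : ℕ∞) ≤ ⊤))
  rw [fderiv_clm_apply hd (differentiableAt_const _), fderiv_clm_apply hd (differentiableAt_const _)]
  simpa using hs.eq (0, 1) (1, 0)

theorem nullWave {φ : ℝ → E3 → ℝ}
    (hφ : ContDiff ℝ (⊤ : ℕ∞) (fun p : ℝ × E3 => φ p.1 p.2))
    (hrad : ∀ t, Radial (φ t)) {S : ℝ → E3 → ℝ}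
    (heq : ∀ (t : ℝ) (x : E3), 0 ≤ t → box φ t x = S t x)
    (h0 : ∀ x : E3, 1 < ‖x‖ → φ 0 x = 0) (h1 : ∀ x : E3, 1 < ‖x‖ → dtP φ 0 x = 0) :
    NullWave (nullF φ) (nullG φ) (fun u v => nullF S u v) where
  cont := (contDiff_profile hφ).continuous.comp (by fun_prop)
  symm u v := by
    rw [nullF, nullF, profile, profile]
    simp only
    rw [← (hrad _).neg_axis, add_comm u v]
    congr 2; ring
  derivV := hasDerivAt_nullF hφ
  derivU u v huv := by
    have hu1 : HasDerivAt (fun w : ℝ => (w + v) / 2) (1 / 2) u :=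
      ((hasDerivAt_id u).add_const v).div_const 2
    have hu2 : HasDerivAt (fun w : ℝ => (v - w) / 2) (-1 / 2) u :=
      ((hasDerivAt_id u).const_sub v).div_const 2
    have hg := hasDerivAt_comp_pair ((contDiff_profile hφ).differentiable (by simp)) hu1 hu2
    have ht := hasDerivAt_comp_pair
      ((contDiff_fderiv_profile hφ (1, 0)).differentiable (by simp)) hu1 hu2
    have hr := hasDerivAt_comp_pair
      ((contDiff_fderiv_profile hφ (0, 1)).differentiable (by simp)) hu1 hu2
    refine ((hg.div_const 2).add (hu2.mul ((ht.add hr).div_const 2))).congr_deriv ?_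
    rw [fderiv_profile_symm hφ]
    by_cases huv' : u = v
    · subst huv'
      have hodd : fderiv ℝ (profile φ) (u, 0) (0, 1) = 0 := by
        have h3 := (hasDerivAt_profile_snd hφ u (-0)).scomp 0 (hasDerivAt_neg 0)
        have h4 : ((fun r : ℝ => profile φ (u, r)) ∘ Neg.neg) = fun r : ℝ => profile φ (u, r) := by
          funext s; exact (hrad u).neg_axis s
        rw [h4] at h3
        have := h3.unique (hasDerivAt_profile_snd hφ u 0)
        simp at this
        linarith
      simp [hodd]
      ring
    · have hne : (v - u) / 2 ≠ 0 := by
        intro h; apply huv'; linarith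
      have hb := heq ((u + v) / 2) (((v - u) / 2) • axisVec) (by linarith)
      rw [box_profile hφ hrad _ hne] at hb
      have : nullF S u v = S ((u + v) / 2) (((v - u) / 2) • axisVec) := rfl
      rw [this, ← hb]
      have : v - u ≠ 0 := by intro h; apply hne; rw [h]; simp
      simp only [Pi.add_apply]
      field_simp
      ring
  zero_f v hv := by
    have : nullF φ (-v) v = φ 0 (v • axisVec) := by
      rw [nullF, profile]; simp only; congr 2 <;> ring
    rw [this]
    exact h0 _ (by rw [norm_smul, norm_axisVec, Real.norm_of_nonneg] <;> linarith)
  zero_D v hv := by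
    have hn : ∀ w : ℝ, 1 < w → 1 < ‖w • axisVec‖ := fun w hw => by
      rw [norm_smul, norm_axisVec, Real.norm_of_nonneg] <;> linarith
    have e1 : (-v + v) / 2 = 0 := by ring
    have e2 : (v - -v) / 2 = v := by ring
    have hr : fderiv ℝ (profile φ) (0, v) (0, 1) = 0 := by
      have h3 : (fun w => profile φ (0, w)) =ᶠ[nhds v] fun _ => (0 : ℝ) := by
        filter_upwards [lt_mem_nhds hv] with w hw
        exact h0 _ (hn w hw)
      exact (hasDerivAt_profile_snd hφ 0 v).unique
        ((hasDerivAt_const v (0 : ℝ)).congr_of_eventuallyEq h3)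
    rw [nullD, nullF, nullG, e1, e2, hr, ← dtP_profile hφ, h1 _ (hn v hv), profile]
    simp only
    rw [h0 _ (hn v hv)]
    simp

theorem nullF_sub_add (φ : ℝ → E3 → ℝ) (t r : ℝ) :
    nullF φ (t - r) (t + r) = φ t (r • axisVec) := by
  rw [nullF, profile]
  simp only
  congr 2 <;> ring

/-- A free radial wave with vanishing radiation field has vanishing data. -/
theorem data_eq_zero {φ : ℝ → E3 → ℝ}
    (hφ : ContDiff ℝ (⊤ : ℕ∞) (fun p : ℝ × E3 => φ p.1 p.2)) (hrad : ∀ t, Radial (φ t))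
    (hw : NullWave (nullF φ) (nullG φ) (fun _ _ => 0))
    (h0 : ∀ u ∈ Icc (-2 : ℝ) 2, (4 - u) / 2 * nullF φ u 4 = 0) (x : E3) :
    φ 0 x = 0 ∧ dtP φ 0 x = 0 := by
  have hpos : ∀ t r : ℝ, 0 ≤ t → 0 < r → φ t (r • axisVec) = 0 := fun t r ht hr => by
    rw [← nullF_sub_add φ t r]
    exact hw.free_unique h0 (by linarith) (by linarith)
  have hall : ∀ t : ℝ, 0 ≤ t → ∀ x, φ t x = 0 := by
    intro t ht x
    have hc : Continuous fun r => profile φ (t, r) :=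
      (contDiff_profile hφ).continuous.comp (by fun_prop)
    have hcl : closure (Ioi (0 : ℝ)) ⊆ {r | profile φ (t, r) = 0} :=
      (isClosed_eq hc continuous_const).closure_subset_iff.2 fun r hr => hpos t r ht hr
    rw [closure_Ioi] at hcl
    rw [(hrad t).eq_axis]
    exact hcl (norm_nonneg x)
  refine ⟨hall 0 le_rfl x, ?_⟩
  have hd : HasDerivAt (fun s => φ s x) (dtP φ 0 x) 0 := by
    have : Differentiable ℝ fun s => φ s x :=
      (hφ.comp (contDiff_id.prodMk contDiff_const)).differentiable (by simp)
    exact (this 0).hasDerivAt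
  have h1 : HasDerivWithinAt (fun s => φ s x) 0 (Ici 0) 0 :=
    (hasDerivWithinAt_const (0 : ℝ) (Ici 0) (0 : ℝ)).congr (fun s hs => hall s hs x)
      (hall 0 le_rfl x)
  exact (uniqueDiffOn_Ici (0 : ℝ) 0 self_mem_Ici).eq_deriv _ hd.hasDerivWithinAt h1

/-- Counterexample to the quadratic weak null conjecture: if `(φ₁, φ₂, φ₃, φ₄)` is a
global smooth solution of the cascade `□φ₁ = 0`, `□φ₂ = φ₁²`, `□φ₃ = φ₂²`, `□φ₄ = φ₃²`
with smooth radial data in the unit ball whose `φ₁`-part is not identically zero, then at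
least one of the two equations `(1 ± ∂_vφ₄)·□η = (∂_vφ₄)²` admits no global smooth
solution `η` on `[0,∞) × ℝ³`. -/
theorem stmt_17 (φ1 φ2 φ3 φ4 : ℝ → E3 → ℝ)
    (hsm : ContDiff ℝ (⊤ : ℕ∞) (fun p : ℝ × E3 => φ1 p.1 p.2) ∧
      ContDiff ℝ (⊤ : ℕ∞) (fun p : ℝ × E3 => φ2 p.1 p.2) ∧
      ContDiff ℝ (⊤ : ℕ∞) (fun p : ℝ × E3 => φ3 p.1 p.2) ∧
      ContDiff ℝ (⊤ : ℕ∞) (fun p : ℝ × E3 => φ4 p.1 p.2))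
    (hrad : (∀ t, Radial (φ1 t)) ∧ (∀ t, Radial (φ2 t)) ∧
      (∀ t, Radial (φ3 t)) ∧ (∀ t, Radial (φ4 t)))
    (heq1 : ∀ (t : ℝ) (x : E3), 0 ≤ t → box φ1 t x = 0)
    (heq2 : ∀ (t : ℝ) (x : E3), 0 ≤ t → box φ2 t x = (φ1 t x) ^ (2 : ℕ))
    (heq3 : ∀ (t : ℝ) (x : E3), 0 ≤ t → box φ3 t x = (φ2 t x) ^ (2 : ℕ))
    (heq4 : ∀ (t : ℝ) (x : E3), 0 ≤ t → box φ4 t x = (φ3 t x) ^ (2 : ℕ))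
    (hdata_supp : ∀ x : E3, 1 < ‖x‖ →
      φ1 0 x = 0 ∧ φ2 0 x = 0 ∧ φ3 0 x = 0 ∧ φ4 0 x = 0 ∧
      dtP φ1 0 x = 0 ∧ dtP φ2 0 x = 0 ∧ dtP φ3 0 x = 0 ∧ dtP φ4 0 x = 0)
    (hnontriv : ¬ ∀ x : E3, φ1 0 x = 0 ∧ dtP φ1 0 x = 0) :
    (¬ ∃ η : ℝ → E3 → ℝ, ContDiff ℝ (⊤ : ℕ∞) (fun p : ℝ × E3 => η p.1 p.2) ∧
      ∀ (t : ℝ) (x : E3), 0 ≤ t →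
        (1 + dvNull φ4 t x) * box η t x = (dvNull φ4 t x) ^ (2 : ℕ)) ∨
    (¬ ∃ η : ℝ → E3 → ℝ, ContDiff ℝ (⊤ : ℕ∞) (fun p : ℝ × E3 => η p.1 p.2) ∧
      ∀ (t : ℝ) (x : E3), 0 ≤ t →
        (1 - dvNull φ4 t x) * box η t x = (dvNull φ4 t x) ^ (2 : ℕ)) := by
  by_contra hcon
  push Not at hcon
  obtain ⟨⟨η₁, -, hη₁⟩, ⟨η₂, -, hη₂⟩⟩ := hcon
  obtain ⟨hs1, hs2, hs3, hs4⟩ := hsm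
  obtain ⟨hr1, hr2, hr3, hr4⟩ := hrad
  have w1 : NullWave (nullF φ1) (nullG φ1) (fun _ _ => 0) :=
    nullWave hs1 hr1 (S := fun _ _ => 0) heq1 (fun x hx => (hdata_supp x hx).1)
      (fun x hx => (hdata_supp x hx).2.2.2.2.1)
  have w2 : NullWave (nullF φ2) (nullG φ2) (fun u v => nullF φ1 u v ^ 2) :=
    nullWave hs2 hr2 heq2 (fun x hx => (hdata_supp x hx).2.1)
      (fun x hx => (hdata_supp x hx).2.2.2.2.2.1)
  have w3 : NullWave (nullF φ3) (nullG φ3) (fun u v => nullF φ2 u v ^ 2) :=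
    nullWave hs3 hr3 heq3 (fun x hx => (hdata_supp x hx).2.2.1)
      (fun x hx => (hdata_supp x hx).2.2.2.2.2.2.1)
  have w4 : NullWave (nullF φ4) (nullG φ4) (fun u v => nullF φ3 u v ^ 2) :=
    nullWave hs4 hr4 heq4 (fun x hx => (hdata_supp x hx).2.2.2.1)
      (fun x hx => (hdata_supp x hx).2.2.2.2.2.2.2)
  have hne : ∃ u ∈ Icc (-2 : ℝ) 2, (4 - u) / 2 * nullF φ1 u 4 ≠ 0 := by
    by_contra h
    push Not at h
    exact hnontriv (data_eq_zero hs1 hr1 w1 h)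
  have hdv : ∀ u v : ℝ, u < v →
      dvNull φ4 ((u + v) / 2) (((v - u) / 2) • axisVec) = 2 * nullG φ4 u v := fun u v huv => by
    rw [dvNull_profile hs4 _ (by linarith), nullG]; ring
  have hne1 : ∀ u v : ℝ, 0 ≤ u + v → u < v → nullG φ4 u v ≠ 1 / 2 := by
    intro u v huv hlt h
    have := hη₂ ((u + v) / 2) (((v - u) / 2) • axisVec) (by linarith)
    rw [hdv u v hlt, h] at this
    norm_num at this
  have hne2 : ∀ u v : ℝ, 0 ≤ u + v → u < v → nullG φ4 u v ≠ -(1 / 2) := by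
    intro u v huv hlt h
    have := hη₁ ((u + v) / 2) (((v - u) / 2) • axisVec) (by linarith)
    rw [hdv u v hlt, h] at this
    norm_num at this
  have hzero : nullG φ4 (-2) 3 = 0 := by
    have hz1 := @NullWave.exterior _ _ _ w1 (fun _ _ _ _ => rfl)
    have hz2 := @NullWave.exterior _ _ _ w2 (fun u v hu huv => by simp [hz1 hu huv])
    have hz3 := @NullWave.exterior _ _ _ w3 (fun u v hu huv => by simp [hz2 hu huv])
    have hz4 := @NullWave.exterior _ _ _ w4 (fun u v hu huv => by simp [hz3 hu huv])
    have h3 : (fun w => nullF φ4 (-2) w) =ᶠ[nhds 3] fun _ => (0 : ℝ) := by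
      filter_upwards [lt_mem_nhds (by norm_num : (2 : ℝ) < 3)] with w hw
      exact hz4 (by norm_num) (by linarith)
    exact (w4.derivV (-2) 3).unique ((hasDerivAt_const _ (0 : ℝ)).congr_of_eventuallyEq h3)
  have hconn : IsPreconnected {p : ℝ × ℝ | 0 ≤ p.1 + p.2 ∧ p.1 < p.2} := by
    refine Convex.isPreconnected fun p hp q hq a b ha hb hab => ⟨?_, ?_⟩
    · have := mul_nonneg ha hp.1
      have := mul_nonneg hb hq.1
      simp only [Prod.fst_add, Prod.smul_fst, Prod.snd_add, Prod.smul_snd, smul_eq_mul]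
      linarith
    · simp only [Prod.fst_add, Prod.smul_fst, Prod.snd_add, Prod.smul_snd, smul_eq_mul]
      rcases ha.eq_or_lt with rfl | ha'
      · have : b = 1 := by linarith
        subst this
        linarith [hq.2]
      · have := mul_lt_mul_of_pos_left hp.2 ha'
        have := mul_le_mul_of_nonneg_left hq.2.le hb
        linarith
  have hcont : Continuous fun p : ℝ × ℝ => nullG φ4 p.1 p.2 := by
    have ht := (contDiff_fderiv_profile hs4 (1, 0)).continuous
    have hr := (contDiff_fderiv_profile hs4 (0, 1)).continuous
    have hm : Continuous fun p : ℝ × ℝ => ((p.1 + p.2) / 2, (p.2 - p.1) / 2) := by fun_prop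
    exact ((ht.comp hm).add (hr.comp hm)).div_const 2
  have hbase : ((-2, 3) : ℝ × ℝ) ∈ {p : ℝ × ℝ | 0 ≤ p.1 + p.2 ∧ p.1 < p.2} := by
    constructor <;> norm_num
  refine cascade_false w1 w2 w3 w4 hne fun u v huv hlt => abs_le.2 ⟨?_, ?_⟩
  · by_contra! hG
    obtain ⟨p, hp, hp'⟩ := hconn.intermediate_value (a := (u, v)) ⟨huv, hlt⟩ hbase
      hcont.continuousOn (show -(1 / 2 : ℝ) ∈ Icc _ _ from ⟨hG.le, by simp [hzero]⟩)
    exact hne2 _ _ hp.1 hp.2 hp'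
  · by_contra! hG
    obtain ⟨p, hp, hp'⟩ := hconn.intermediate_value hbase (b := (u, v)) ⟨huv, hlt⟩
      hcont.continuousOn (show (1 / 2 : ℝ) ∈ Icc _ _ from ⟨by simp [hzero], hG.le⟩)
    exact hne1 _ _ hp.1 hp.2 hp'

end
end
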